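/- arXiv:1504.01612 — 4 statements merged into one kernel-verified Lean document; each statement's English description precedes it below -/
import Mathlib

section
/- Fix α ∈ (0,1) and set x_n = ⌊αn⌋. Let Z_n be a random variable with density f_{n,x_n} and let Z̃_n = √n · (α(1−α))^{−1/2} · (Z_n − α). Then Z̃_n converges weakly (in distribution) to a standard Gaussian random variable as n → ∞. -/
open MeasureTheory Real Filter

/-- The Beta(x+1, n-x+1) posterior density `f_{n,x}` on `[0,1]`, extended by `0` outside. -/
noncomputable def betaDensity (n x : ℕ) (p : ℝ) : ℝ :=
  if 0 ≤ p ∧ p ≤ 1 then ((n : ℝ) + 1) * (n.choose x : ℝ) * p ^ x * (1 - p) ^ (n - x) else 0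

/-- The standard Gaussian density. -/
noncomputable def stdGaussianDensity (z : ℝ) : ℝ :=
  Real.exp (-z ^ 2 / 2) / Real.sqrt (2 * Real.pi)

/-- Density of the standardized variable `Z̃_n = √n (α(1-α))^{-1/2} (Z_n - α)` where `Z_n`
has density `f_{n, ⌊αn⌋}`. -/
noncomputable def tildeDensityAlpha (α : ℝ) (n : ℕ) (z : ℝ) : ℝ :=
  (Real.sqrt (α * (1 - α)) / Real.sqrt n) *
    betaDensity n (Nat.floor (α * n))
      (α + Real.sqrt (α * (1 - α)) / Real.sqrt n * z)

lemma integral_betaPDFReal_eq_one {a b : ℝ} (ha : 0 < a) (hb : 0 < b) :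
    ∫ p, ProbabilityTheory.betaPDFReal a b p = 1 := by
  rw [integral_eq_lintegral_of_nonneg_ae]
  · exact (ENNReal.toReal_eq_one_iff _).2 (ProbabilityTheory.lintegral_betaPDF_eq_one ha hb)
  · refine ae_of_all _ fun p => ?_
    by_cases h : 0 < p ∧ p < 1
    · exact (ProbabilityTheory.betaPDFReal_pos h.1 h.2 ha hb).le
    · simp [ProbabilityTheory.betaPDFReal, h]
  · fun_prop

lemma betaDensity_ae_eq_betaPDFReal {n x : ℕ} (hx : x ≤ n) :
    betaDensity n x =ᵐ[volume]
      ProbabilityTheory.betaPDFReal ((x : ℝ) + 1) (((n - x : ℕ) : ℝ) + 1) := by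
  filter_upwards [compl_mem_ae_iff.2 (measure_singleton (0 : ℝ)),
    compl_mem_ae_iff.2 (measure_singleton (1 : ℝ))] with p h0 h1
  have h0 : p ≠ 0 := h0
  have h1 : p ≠ 1 := h1
  have hiff : (0 ≤ p ∧ p ≤ 1) ↔ (0 < p ∧ p < 1) :=
    ⟨fun h => ⟨h.1.lt_of_ne' h0, h.2.lt_of_ne h1⟩, fun h => ⟨h.1.le, h.2.le⟩⟩
  have hconst : ((n : ℝ) + 1) * (n.choose x : ℝ) =
      1 / ProbabilityTheory.beta ((x : ℝ) + 1) (((n - x : ℕ) : ℝ) + 1) := by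
    have hsum : (x : ℝ) + 1 + (((n - x : ℕ) : ℝ) + 1) = ((n + 1 : ℕ) : ℝ) + 1 := by
      push_cast [Nat.cast_sub hx]; ring
    rw [ProbabilityTheory.beta, hsum, Gamma_nat_eq_factorial, Gamma_nat_eq_factorial,
      Gamma_nat_eq_factorial, Nat.cast_choose ℝ hx, Nat.factorial_succ]
    push_cast
    field_simp
  simp only [betaDensity, ProbabilityTheory.betaPDFReal, hiff, hconst, add_sub_cancel_right,
    rpow_natCast]

lemma integral_betaDensity {n x : ℕ} (hx : x ≤ n) : ∫ p, betaDensity n x p = 1 := by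
  rw [integral_congr_ae (betaDensity_ae_eq_betaPDFReal hx)]
  exact integral_betaPDFReal_eq_one (by positivity) (by positivity)

lemma floor_mul_le_self {α : ℝ} (hα : α ∈ Set.Ioo (0 : ℝ) 1) (n : ℕ) : ⌊α * n⌋₊ ≤ n := by
  apply Nat.floor_le_of_le
  have := hα.2
  nlinarith [(Nat.cast_nonneg n : (0 : ℝ) ≤ n)]

lemma integral_tildeDensityAlpha {α : ℝ} (hα : α ∈ Set.Ioo (0 : ℝ) 1) {n : ℕ} (hn : n ≠ 0) :
    ∫ z, tildeDensityAlpha α n z = 1 := by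
  have hσ : 0 < √(α * (1 - α)) := sqrt_pos.2 (mul_pos hα.1 (sub_pos.2 hα.2))
  have hs : 0 < √(α * (1 - α)) / √n := by positivity
  unfold tildeDensityAlpha
  rw [integral_const_mul, Measure.integral_comp_mul_left
    (fun y => betaDensity n ⌊α * n⌋₊ (α + y)) (√(α * (1 - α)) / √n),
    integral_add_left_eq_self (betaDensity n ⌊α * n⌋₊) α,
    integral_betaDensity (floor_mul_le_self hα n), abs_of_pos (inv_pos.2 hs)]
  rw [smul_eq_mul, mul_one, mul_inv_cancel₀ hs.ne']

/-- The likelihood ratio of `p` against `α` after `⌊αn⌋` successes in `n` trials, as a function of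
the standardized variable `z`, where `p = α + √(α(1-α)/n) z`. -/
noncomputable def likelihoodRatio (α : ℝ) (n : ℕ) (z : ℝ) : ℝ :=
  if 0 ≤ α + √(α * (1 - α)) / √n * z ∧ α + √(α * (1 - α)) / √n * z ≤ 1 then
    ((α + √(α * (1 - α)) / √n * z) / α) ^ ⌊α * n⌋₊ *
      ((1 - (α + √(α * (1 - α)) / √n * z)) / (1 - α)) ^ (n - ⌊α * n⌋₊)
  else 0

lemma measurable_likelihoodRatio (α : ℝ) (n : ℕ) : Measurable (likelihoodRatio α n) := by
  have hm : Measurable fun z => α + √(α * (1 - α)) / √n * z := by fun_prop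
  exact Measurable.ite ((measurableSet_le measurable_const hm).inter
    (measurableSet_le hm measurable_const)) (by fun_prop) (by fun_prop)

lemma exists_tildeDensityAlpha_eq_mul_likelihoodRatio {α : ℝ} (hα : α ∈ Set.Ioo (0 : ℝ) 1)
    (n : ℕ) : ∃ K : ℝ, ∀ z, tildeDensityAlpha α n z = K * likelihoodRatio α n z := by
  have h0 : α ≠ 0 := hα.1.ne'
  have h1 : 1 - α ≠ 0 := (sub_pos.2 hα.2).ne'
  refine ⟨√(α * (1 - α)) / √n * ((n + 1) * (n.choose ⌊α * n⌋₊ : ℝ) * α ^ ⌊α * n⌋₊ *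
    (1 - α) ^ (n - ⌊α * n⌋₊)), fun z => ?_⟩
  simp only [tildeDensityAlpha, betaDensity, likelihoodRatio]
  split_ifs
  · rw [div_pow, div_pow]
    field_simp
  · simp

lemma le_exp_sub_one_sub_sq {y K : ℝ} (hy : 0 ≤ y) (hyK : y ≤ K) :
    y ≤ exp (y - 1 - (y - 1) ^ 2 / (√K + 1) ^ 2) := by
  have hs := sqrt_nonneg y
  have hsK : √y ≤ √K := sqrt_le_sqrt hyK
  have hsq : √y ^ 2 = y := sq_sqrt hy
  have h1 : √y ≤ exp (√y - 1) := by simpa using add_one_le_exp (√y - 1)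
  have h2 : y ≤ exp (2 * (√y - 1)) := by
    calc y = √y ^ 2 := hsq.symm
      _ ≤ exp (√y - 1) ^ 2 := by gcongr
      _ = exp (2 * (√y - 1)) := by rw [← exp_nat_mul]; norm_num
  refine h2.trans (exp_le_exp.2 ?_)
  have h3 : (y - 1) ^ 2 / (√K + 1) ^ 2 ≤ (√y - 1) ^ 2 := by
    rw [div_le_iff₀ (by positivity)]
    calc (y - 1) ^ 2 = (√y - 1) ^ 2 * (√y + 1) ^ 2 := by
          rw [← mul_pow]; congr 1; linear_combination -hsq
      _ ≤ (√y - 1) ^ 2 * (√K + 1) ^ 2 := by gcongr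
  nlinarith

lemma div_pow_mul_div_pow_le {α p : ℝ} {n x : ℕ} (hα : α ∈ Set.Ioo (0 : ℝ) 1) (hxn : x ≤ n)
    (hx : (x : ℝ) ≤ α * n) (hx' : α * n ≤ x + 1) (hp0 : 0 ≤ p) (hp1 : p ≤ 1) :
    (p / α) ^ x * ((1 - p) / (1 - α)) ^ (n - x) ≤
      exp (1 / (α * (1 - α))) *
        exp (-(n * (p - α) ^ 2 / ((1 - α) * (√(1 / (1 - α)) + 1) ^ 2))) := by
  have h0 : 0 < α := hα.1
  have h1 : 0 < 1 - α := sub_pos.2 hα.2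
  set S := (√(1 / (1 - α)) + 1) ^ 2 with hS
  have hSpos : 0 < S := by positivity
  have hA : p / α ≤ exp (p / α - 1) := by simpa using add_one_le_exp (p / α - 1)
  have hB : (1 - p) / (1 - α) ≤ exp ((1 - p) / (1 - α) - 1 - ((1 - p) / (1 - α) - 1) ^ 2 / S) :=
    le_exp_sub_one_sub_sq (div_nonneg (sub_nonneg.2 hp1) h1.le) (by gcongr; linarith)
  have hw : (1 - p) / (1 - α) - 1 = -((p - α) / (1 - α)) := by field_simp; ring
  calc (p / α) ^ x * ((1 - p) / (1 - α)) ^ (n - x)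
      ≤ exp (p / α - 1) ^ x *
        exp ((1 - p) / (1 - α) - 1 - ((1 - p) / (1 - α) - 1) ^ 2 / S) ^ (n - x) := by
        have : 0 ≤ 1 - p := sub_nonneg.2 hp1
        gcongr
    _ = exp (x * (p / α - 1) + (n - x) *
        ((1 - p) / (1 - α) - 1 - ((1 - p) / (1 - α) - 1) ^ 2 / S)) := by
        rw [← exp_nat_mul, ← exp_nat_mul, ← exp_add, Nat.cast_sub hxn]
    _ ≤ exp (1 / (α * (1 - α)) + -(n * (p - α) ^ 2 / ((1 - α) * S))) := by
        rw [exp_le_exp, hw]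
        have e : x * (p / α - 1) + (n - x) * (-((p - α) / (1 - α)) - (-((p - α) / (1 - α))) ^ 2 / S)
            = ((p - α) * (x - α * n)) / (α * (1 - α)) +
              -((n - x) * ((p - α) ^ 2 / ((1 - α) ^ 2 * S))) := by
          field_simp
          ring
        have e' : n * (p - α) ^ 2 / ((1 - α) * S) =
            (1 - α) * n * ((p - α) ^ 2 / ((1 - α) ^ 2 * S)) := by
          field_simp
        rw [e, e']
        have : (p - α) * (x - α * n) ≤ 1 := by nlinarith
        gcongr
        linarith
    _ = _ := exp_add _ _

lemma likelihoodRatio_nonneg {α : ℝ} (hα : α ∈ Set.Ioo (0 : ℝ) 1) (n : ℕ) (z : ℝ) :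
    0 ≤ likelihoodRatio α n z := by
  rw [likelihoodRatio]
  split_ifs with h
  · exact mul_nonneg (pow_nonneg (div_nonneg h.1 hα.1.le) _)
      (pow_nonneg (div_nonneg (sub_nonneg.2 h.2) (sub_pos.2 hα.2).le) _)
  · exact le_rfl

lemma exists_likelihoodRatio_le {α : ℝ} (hα : α ∈ Set.Ioo (0 : ℝ) 1) :
    ∃ C c : ℝ, 0 < c ∧ ∀ n : ℕ, n ≠ 0 → ∀ z, likelihoodRatio α n z ≤ C * exp (-c * z ^ 2) := by
  have h0 : 0 < α := hα.1
  have h1 : 0 < 1 - α := sub_pos.2 hα.2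
  refine ⟨exp (1 / (α * (1 - α))), α / (√(1 / (1 - α)) + 1) ^ 2, by positivity,
    fun n hn z => ?_⟩
  rw [likelihoodRatio]
  split_ifs with h
  · refine (div_pow_mul_div_pow_le hα (floor_mul_le_self hα n) (Nat.floor_le (by positivity))
      (Nat.lt_floor_add_one _).le h.1 h.2).trans_eq ?_
    congr 2
    have hn' : (n : ℝ) ≠ 0 := by exact_mod_cast hn
    rw [add_sub_cancel_left, mul_pow, div_pow, sq_sqrt (by positivity), sq_sqrt (by positivity)]
    field_simp
  · positivity

lemma tendsto_mul_log_one_add_div_sqrt_sub (b : ℝ) :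
    Tendsto (fun n : ℕ => (n : ℝ) * (log (1 + b / √n) - b / √n)) atTop (nhds (-(b ^ 2 / 2))) := by
  have hy : Tendsto (fun n : ℕ => b / √(n : ℝ)) atTop (nhds 0) :=
    tendsto_const_nhds.div_atTop (tendsto_sqrt_atTop.comp tendsto_natCast_atTop_atTop)
  have habs : Tendsto (fun n : ℕ => |b / √(n : ℝ)|) atTop (nhds 0) := by simpa using hy.abs
  have hbound : Tendsto (fun n : ℕ => b ^ 2 * |b / √(n : ℝ)| / (1 - |b / √(n : ℝ)|)) atTop
      (nhds 0) := by
    convert (habs.const_mul (b ^ 2)).div (habs.const_sub 1) (by norm_num) using 2 <;> simp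
  rw [← tendsto_sub_nhds_zero_iff]
  refine squeeze_zero_norm' ?_ hbound
  filter_upwards [habs.eventually (gt_mem_nhds one_pos), eventually_ne_atTop 0] with n hlt hn
  have hn' : (0 : ℝ) < n := by positivity
  have hsq : n * (b / √(n : ℝ)) ^ 2 = b ^ 2 := by
    rw [div_pow, sq_sqrt hn'.le]; field_simp
  set y := b / √(n : ℝ)
  have hy := abs_log_sub_add_sum_range_le (x := -y) (by rwa [abs_neg]) 2
  rw [abs_neg] at hy
  have e : (n : ℝ) * (log (1 + y) - y) - -(b ^ 2 / 2) =
      n * ((∑ i ∈ Finset.range 2, (-y) ^ (i + 1) / ((i : ℝ) + 1)) + log (1 - -y)) := by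
    rw [← hsq]
    simp only [Finset.sum_range_succ, Finset.sum_range_zero, sub_neg_eq_add]
    push_cast
    ring
  rw [e, norm_mul, norm_eq_abs, norm_eq_abs, abs_of_pos hn']
  calc (n : ℝ) * _ ≤ n * (|y| ^ (2 + 1) / (1 - |y|)) := by gcongr
    _ = b ^ 2 * |y| / (1 - |y|) := by rw [← hsq, ← sq_abs y]; ring

lemma tendsto_floor_mul_div_nat {α : ℝ} (hα : 0 ≤ α) :
    Tendsto (fun n : ℕ => (⌊α * n⌋₊ : ℝ) / n) atTop (nhds α) :=
  (tendsto_nat_floor_mul_div_atTop hα).comp tendsto_natCast_atTop_atTop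

lemma tendsto_likelihoodRatio {α : ℝ} (hα : α ∈ Set.Ioo (0 : ℝ) 1) (z : ℝ) :
    Tendsto (fun n => likelihoodRatio α n z) atTop (nhds (exp (-z ^ 2 / 2))) := by
  have h0 : 0 < α := hα.1
  have h1 : 0 < 1 - α := sub_pos.2 hα.2
  set σ := √(α * (1 - α)) with hσ
  have hσ2 : σ ^ 2 = α * (1 - α) := sq_sqrt (by positivity)
  have hsqrt : Tendsto (fun n : ℕ => √(n : ℝ)) atTop atTop :=
    tendsto_sqrt_atTop.comp tendsto_natCast_atTop_atTop
  have hp : Tendsto (fun n : ℕ => α + σ / √(n : ℝ) * z) atTop (nhds α) := by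
    simpa using ((tendsto_const_nhds.div_atTop hsqrt).mul_const z).const_add α
  have hx := tendsto_floor_mul_div_nat h0.le
  have hδ : Tendsto (fun n : ℕ => ((⌊α * n⌋₊ : ℝ) - α * n) * (z / σ) / √(n : ℝ)) atTop
      (nhds 0) := by
    have hb : Tendsto (fun n : ℕ => |z / σ| / √(n : ℝ)) atTop (nhds 0) :=
      tendsto_const_nhds.div_atTop hsqrt
    refine squeeze_zero_norm (fun n => ?_) hb
    have hl : |(⌊α * n⌋₊ : ℝ) - α * n| ≤ 1 := by
      rw [abs_le]
      constructor <;> linarith [Nat.floor_le (by positivity : 0 ≤ α * n),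
        Nat.lt_floor_add_one (α * n)]
    rw [norm_eq_abs, abs_div, abs_mul, abs_of_nonneg (sqrt_nonneg (n : ℝ))]
    gcongr
    exact mul_le_of_le_one_left (abs_nonneg _) hl
  have hlog : Tendsto (fun n : ℕ =>
      (⌊α * n⌋₊ : ℝ) / n * (n * (log (1 + σ * z / α / √n) - σ * z / α / √n)) +
      (1 - (⌊α * n⌋₊ : ℝ) / n) *
        (n * (log (1 + -(σ * z / (1 - α)) / √n) - -(σ * z / (1 - α)) / √n)) +
      ((⌊α * n⌋₊ : ℝ) - α * n) * (z / σ) / √n) atTop (nhds (-z ^ 2 / 2)) := by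
    have := ((hx.mul (tendsto_mul_log_one_add_div_sqrt_sub (σ * z / α))).add
      ((hx.const_sub 1).mul (tendsto_mul_log_one_add_div_sqrt_sub (-(σ * z / (1 - α)))))).add hδ
    convert this using 2
    rw [neg_sq, div_pow, div_pow, mul_pow, hσ2]
    field_simp
    ring
  refine ((continuous_exp.tendsto _).comp hlog).congr' ?_
  filter_upwards [hp.eventually (lt_mem_nhds h0), hp.eventually (gt_mem_nhds hα.2),
    eventually_ne_atTop 0] with n hp0 hp1 hn
  have hn' : (0 : ℝ) < n := by positivity
  have hσpos : 0 < σ := sqrt_pos.2 (mul_pos h0 h1)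
  rw [likelihoodRatio, if_pos ⟨hp0.le, hp1.le⟩, ← hσ]
  have eA : (α + σ / √(n : ℝ) * z) / α = 1 + σ * z / α / √n := by field_simp
  have eB : (1 - (α + σ / √(n : ℝ) * z)) / (1 - α) = 1 + -(σ * z / (1 - α)) / √n := by
    field_simp
    ring
  have hA : 0 < 1 + σ * z / α / √(n : ℝ) := eA ▸ div_pos hp0 h0
  have hB : 0 < 1 + -(σ * z / (1 - α)) / √(n : ℝ) := eB ▸ div_pos (sub_pos.2 hp1) h1
  rw [eA, eB, Function.comp_apply]
  conv_rhs => rw [← exp_log hA, ← exp_log hB]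
  rw [← exp_nat_mul, ← exp_nat_mul, ← exp_add, Nat.cast_sub (floor_mul_le_self hα n)]
  congr 1
  generalize log (1 + σ * z / α / √(n : ℝ)) = A
  generalize log (1 + -(σ * z / (1 - α)) / √(n : ℝ)) = B
  generalize (⌊α * n⌋₊ : ℝ) = x
  have hz : z / σ = σ * z / (α * (1 - α)) := by rw [← hσ2]; field_simp
  rw [hz]
  field_simp
  ring

lemma tendsto_integral_mul_likelihoodRatio {α : ℝ} (hα : α ∈ Set.Ioo (0 : ℝ) 1)
    (g : BoundedContinuousFunction ℝ ℝ) :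
    Tendsto (fun n : ℕ => ∫ z, g z * likelihoodRatio α n z) atTop
      (nhds (∫ z, g z * exp (-z ^ 2 / 2))) := by
  obtain ⟨C, c, hc, hC⟩ := exists_likelihoodRatio_le hα
  refine tendsto_integral_filter_of_dominated_convergence
    (fun z => ‖g‖ * (C * exp (-c * z ^ 2))) ?_ ?_ ?_ ?_
  · exact Eventually.of_forall fun n =>
      (g.continuous.measurable.mul (measurable_likelihoodRatio α n)).aestronglyMeasurable
  · filter_upwards [eventually_ne_atTop 0] with n hn
    refine ae_of_all _ fun z => ?_
    rw [norm_mul, norm_of_nonneg (likelihoodRatio_nonneg hα n z)]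
    exact mul_le_mul (g.norm_coe_le_norm z) (hC n hn z) (likelihoodRatio_nonneg hα n z)
      (norm_nonneg g)
  · exact ((integrable_exp_neg_mul_sq hc).const_mul C).const_mul ‖g‖
  · exact ae_of_all _ fun z => (tendsto_likelihoodRatio hα z).const_mul (g z)

lemma integral_exp_neg_sq_div_two : ∫ z : ℝ, exp (-z ^ 2 / 2) = √(2 * π) := by
  have h := integral_gaussian (1 / 2)
  have e : π / (1 / 2) = 2 * π := by ring
  rw [e] at h
  rw [← h]
  congr with z
  ring_nf

/-- For `α ∈ (0,1)` and `x_n = ⌊αn⌋`, the standardized variable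
`Z̃_n = √n (α(1-α))^{-1/2} (Z_n - α)` converges weakly to a standard Gaussian:
for every bounded continuous test function the integrals converge. -/
theorem weak_convergence_to_gaussian_alpha
    (α : ℝ) (hα : α ∈ Set.Ioo (0 : ℝ) 1) :
    ∀ g : BoundedContinuousFunction ℝ ℝ,
      Tendsto (fun n : ℕ => ∫ z : ℝ, g z * tildeDensityAlpha α n z) atTop
        (nhds (∫ z : ℝ, g z * stdGaussianDensity z)) := by
  intro g
  have hone : Tendsto (fun n : ℕ => ∫ z, likelihoodRatio α n z) atTop (nhds √(2 * π)) := by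
    simpa [integral_exp_neg_sq_div_two] using
      tendsto_integral_mul_likelihoodRatio hα (BoundedContinuousFunction.const ℝ 1)
  have hlim := (tendsto_integral_mul_likelihoodRatio hα g).div hone (by positivity)
  have hgauss : ∫ z, g z * stdGaussianDensity z = (∫ z, g z * exp (-z ^ 2 / 2)) / √(2 * π) := by
    simp only [stdGaussianDensity, ← mul_div_assoc, integral_div]
  rw [hgauss]
  refine hlim.congr' ?_
  filter_upwards [eventually_ne_atTop 0] with n hn
  obtain ⟨K, hK⟩ := exists_tildeDensityAlpha_eq_mul_likelihoodRatio hα n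
  have hnorm : K * ∫ z, likelihoodRatio α n z = 1 := by
    rw [← integral_const_mul, ← integral_tildeDensityAlpha hα hn]
    simp only [hK]
  simp only [hK, mul_left_comm _ K, integral_const_mul]
  rw [Pi.div_apply, eq_comm, eq_div_iff (right_ne_zero_of_mul_eq_one hnorm), mul_right_comm, hnorm,
    one_mul]
end

section
/- Fix α ∈ (0,1) and set x_n = ⌊αn⌋. Then the differential entropy of f_{n,x_n} satisfies lim_{n→∞} [ h(f_{n,x_n}) − (1/2)·log( 2πe·α(1−α)/n ) ] = 0; equivalently, the differential entropy of the density of the standardized variable Z̃_n = √n·(α(1−α))^{−1/2}·(Z_n − α), where Z_n has density f_{n,x_n}, converges to (1/2)·log(2πe), the differential entropy of the standard Gaussian. -/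
open MeasureTheory Real Filter

/-- Differential entropy `h(f) = -∫ f log f` (with the convention `0 log 0 = 0`,
which holds automatically since `Real.log 0 = 0`). -/
noncomputable def diffEntropy (f : ℝ → ℝ) : ℝ :=
  -∫ z : ℝ, f z * Real.log (f z)

open Topology in
/-- The second-order term in the expansion of the harmonic numbers. -/
lemma tendsto_mul_harmonic_sub_log_sub_eulerMascheroniConstant :
    Tendsto (fun m : ℕ => (m : ℝ) * (harmonic m - Real.log m - eulerMascheroniConstant)) atTop
      (𝓝 (1 / 2)) := by
  have hlim : Tendsto (fun k : ℕ => (harmonic (k + 1) : ℝ) - Real.log ((k + 1 : ℕ) : ℝ)) atTop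
      (𝓝 eulerMascheroniConstant) :=
    tendsto_harmonic_sub_log.comp (tendsto_add_atTop_nat 1)
  have hinv (c : ℝ) : Tendsto (fun k : ℕ => 1 / (2 * ((k : ℝ) + c))) atTop (𝓝 0) := by
    refine tendsto_const_nhds.div_atTop (Tendsto.const_mul_atTop two_pos ?_)
    exact tendsto_atTop_add_const_right _ _ tendsto_natCast_atTop_atTop
  have hlog (k : ℕ) : Real.log ((k + 1 + 1 : ℕ) : ℝ) =
      Real.log ((k + 1 : ℕ) : ℝ) + Real.log (1 + 1 / ((k : ℝ) + 1)) := by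
    rw [← Real.log_mul (by positivity) (by positivity)]
    congr 1
    push_cast
    field_simp
  have hupper (k : ℕ) : Real.log (1 + 1 / ((k : ℝ) + 1)) ≤
      (1 / ((k : ℝ) + 1) + 1 / ((k : ℝ) + 2)) / 2 := by
    have h1 : (1 : ℝ) ≤ 1 + 1 / ((k : ℝ) + 1) := le_add_of_nonneg_right (by positivity)
    have h := Real.self_le_sinh_iff.2 (Real.log_nonneg h1)
    rw [Real.sinh_log (by positivity)] at h
    refine h.trans_eq ?_
    field_simp
    ring
  have hlower (k : ℕ) : 3 / (2 * ((k : ℝ) + 2)) - 1 / (2 * ((k : ℝ) + 3)) ≤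
      Real.log (1 + 1 / ((k : ℝ) + 1)) := by
    refine le_trans ?_ (Real.le_log_one_add_of_nonneg (by positivity))
    rw [← sub_nonneg]
    have : 2 * (1 / ((k : ℝ) + 1)) / (1 / ((k : ℝ) + 1) + 2) -
        (3 / (2 * ((k : ℝ) + 2)) - 1 / (2 * ((k : ℝ) + 3))) =
        3 / (2 * (2 * (k : ℝ) + 3) * (k + 2) * (k + 3)) := by
      field_simp
      ring
    rw [this]
    positivity
  have hmono : Monotone (fun k : ℕ => (harmonic (k + 1) : ℝ) - Real.log ((k + 1 : ℕ) : ℝ) -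
      1 / (2 * ((k : ℝ) + 1))) := by
    refine monotone_nat_of_le_succ fun k => ?_
    rw [hlog k, harmonic_succ (k + 1)]
    have h := hupper k
    push_cast
    have e : (k : ℝ) + 1 + 1 = k + 2 := by ring
    rw [e]
    have e1 : 1 / (2 * ((k : ℝ) + 1)) = 1 / ((k : ℝ) + 1) / 2 := by field_simp
    have e2 : 1 / (2 * ((k : ℝ) + 2)) = 1 / ((k : ℝ) + 2) / 2 := by field_simp
    rw [e1, e2, inv_eq_one_div]
    linarith
  have hanti : Antitone (fun k : ℕ => (harmonic (k + 1) : ℝ) - Real.log ((k + 1 : ℕ) : ℝ) -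
      1 / (2 * ((k : ℝ) + 2))) := by
    refine antitone_nat_of_succ_le fun k => ?_
    rw [hlog k, harmonic_succ (k + 1)]
    have h := hlower k
    push_cast
    have e : (k : ℝ) + 1 + 1 = k + 2 := by ring
    have e' : (k : ℝ) + 1 + 2 = k + 3 := by ring
    have e1 : 3 / (2 * ((k : ℝ) + 2)) = ((k : ℝ) + 2)⁻¹ + 1 / (2 * ((k : ℝ) + 2)) := by
      field_simp
      norm_num
    rw [e, e']
    linarith
  have hle (k : ℕ) := hmono.ge_of_tendsto (by simpa using hlim.sub (hinv 1)) k
  have hge (k : ℕ) := hanti.le_of_tendsto (by simpa using hlim.sub (hinv 2)) k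
  rw [← tendsto_add_atTop_iff_nat 1]
  refine tendsto_of_tendsto_of_tendsto_of_le_of_le
    (g := fun k : ℕ => 1 / 2 - 1 / (2 * ((k : ℝ) + 2))) (h := fun _ => 1 / 2)
    (by simpa using tendsto_const_nhds.sub (hinv 2)) tendsto_const_nhds (fun k => ?_) (fun k => ?_)
  · have h := hge k
    have e : (1 : ℝ) / 2 - 1 / (2 * ((k : ℝ) + 2)) =
        ((k + 1 : ℕ) : ℝ) * (1 / (2 * ((k : ℝ) + 2))) := by
      push_cast
      field_simp
      ring
    dsimp only at h ⊢
    rw [e]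
    gcongr
    linarith
  · have h := hle k
    have e : (1 : ℝ) / 2 = ((k + 1 : ℕ) : ℝ) * (1 / (2 * ((k : ℝ) + 1))) := by
      push_cast
      field_simp
    dsimp only at h ⊢
    rw [e]
    gcongr
    linarith

/-- `log m! - m H_m` with its leading terms `-(1 + γ) m + (1 / 2) log m` removed. -/
noncomputable def logFactorialRemainder (m : ℕ) : ℝ :=
  Real.log m.factorial - m * harmonic m + (1 + eulerMascheroniConstant) * m - 1 / 2 * Real.log m

lemma tendsto_logFactorialRemainder :
    Tendsto logFactorialRemainder atTop (nhds (1 / 2 * Real.log (2 * π) - 1 / 2)) := by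
  have h := (((continuousAt_log (by positivity)).tendsto.comp
    Stirling.tendsto_stirlingSeq_sqrt_pi).add_const (1 / 2 * Real.log 2)).sub
    tendsto_mul_harmonic_sub_log_sub_eulerMascheroniConstant
  have e : Real.log √π + 1 / 2 * Real.log 2 - 1 / 2 = 1 / 2 * Real.log (2 * π) - 1 / 2 := by
    rw [Real.log_sqrt pi_pos.le, Real.log_mul two_ne_zero pi_ne_zero]
    ring
  rw [e] at h
  refine h.congr' ?_
  filter_upwards [eventually_gt_atTop 0] with m hm
  have hm' : (m : ℝ) ≠ 0 := by positivity
  simp only [Function.comp, Stirling.log_stirlingSeq_formula, logFactorialRemainder]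
  rw [Real.log_mul two_ne_zero hm', Real.log_div hm' (exp_pos 1).ne', Real.log_exp]
  ring

lemma integral_pow_mul_one_sub_pow (a b : ℕ) :
    ∫ p in (0 : ℝ)..1, p ^ a * (1 - p) ^ b =
      (a.factorial * b.factorial : ℝ) / (a + b + 1).factorial := by
  induction b generalizing a with
  | zero =>
    simp [Nat.factorial_succ]
    field_simp
  | succ b ih =>
    have e (p : ℝ) : p ^ a * (1 - p) ^ (b + 1) =
        p ^ a * (1 - p) ^ b - p ^ (a + 1) * (1 - p) ^ b := by ring
    simp_rw [e]
    rw [intervalIntegral.integral_sub (Continuous.intervalIntegrable (by fun_prop) _ _)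
      (Continuous.intervalIntegrable (by fun_prop) _ _), ih, ih,
      show a + 1 + b + 1 = a + b + 1 + 1 by ring, show a + (b + 1) + 1 = a + b + 1 + 1 by ring,
      Nat.factorial_succ (a + b + 1), Nat.factorial_succ a, Nat.factorial_succ b]
    push_cast
    field_simp
    ring

lemma intervalIntegrable_pow_mul_one_sub_pow_mul_log (a b : ℕ) :
    IntervalIntegrable (fun p : ℝ => p ^ a * (1 - p) ^ b * Real.log p) volume 0 1 :=
  intervalIntegral.intervalIntegrable_log'.continuousOn_mul (by fun_prop)

lemma integral_pow_mul_log (a : ℕ) :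
    ∫ p in (0 : ℝ)..1, p ^ a * Real.log p = -1 / ((a : ℝ) + 1) ^ 2 := by
  have hcont : Continuous (fun p : ℝ => p ^ a * (p * Real.log p) / (a + 1) -
      p ^ (a + 1) / ((a : ℝ) + 1) ^ 2) :=
    ((((continuous_id.pow a).mul continuous_mul_log).div_const _).sub (by fun_prop))
  rw [intervalIntegral.integral_eq_sub_of_hasDerivAt_of_le zero_le_one hcont.continuousOn]
  · simp
    ring
  · intro p hp
    have hp0 : p ≠ 0 := hp.1.ne'
    have h := (((hasDerivAt_pow (a + 1) p).mul (Real.hasDerivAt_log hp0)).div_const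
      ((a : ℝ) + 1)).sub ((hasDerivAt_pow (a + 1) p).div_const (((a : ℝ) + 1) ^ 2))
    convert h using 1
    · funext q
      simp
      ring
    · push_cast
      field_simp
      ring
  · simpa using intervalIntegrable_pow_mul_one_sub_pow_mul_log a 0

lemma integral_pow_mul_one_sub_pow_mul_log (a b : ℕ) :
    ∫ p in (0 : ℝ)..1, p ^ a * (1 - p) ^ b * Real.log p =
      (a.factorial * b.factorial : ℝ) / (a + b + 1).factorial *
        (harmonic a - harmonic (a + b + 1)) := by
  induction b generalizing a with
  | zero =>
    simp only [pow_zero, mul_one, add_zero, integral_pow_mul_log, harmonic_succ,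
      Nat.factorial_succ]
    push_cast
    field_simp
    simp
  | succ b ih =>
    have e (p : ℝ) : p ^ a * (1 - p) ^ (b + 1) * Real.log p =
        p ^ a * (1 - p) ^ b * Real.log p - p ^ (a + 1) * (1 - p) ^ b * Real.log p := by ring
    simp_rw [e]
    rw [intervalIntegral.integral_sub (intervalIntegrable_pow_mul_one_sub_pow_mul_log _ _)
      (intervalIntegrable_pow_mul_one_sub_pow_mul_log _ _), ih, ih,
      show a + 1 + b + 1 = a + b + 1 + 1 by ring, show a + (b + 1) + 1 = a + b + 1 + 1 by ring,
      Nat.factorial_succ (a + b + 1), Nat.factorial_succ a, Nat.factorial_succ b,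
      harmonic_succ (a + b + 1), harmonic_succ a]
    push_cast
    field_simp
    ring

lemma intervalIntegrable_pow_mul_one_sub_pow_mul_log_one_sub (a b : ℕ) :
    IntervalIntegrable (fun p : ℝ => p ^ a * (1 - p) ^ b * Real.log (1 - p)) volume 0 1 := by
  have h := (intervalIntegrable_pow_mul_one_sub_pow_mul_log b a).symm.comp_sub_left 1
  simpa [mul_comm] using h

lemma integral_pow_mul_one_sub_pow_mul_log_one_sub (a b : ℕ) :
    ∫ p in (0 : ℝ)..1, p ^ a * (1 - p) ^ b * Real.log (1 - p) =
      (a.factorial * b.factorial : ℝ) / (a + b + 1).factorial *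
        (harmonic b - harmonic (a + b + 1)) := by
  have h := intervalIntegral.integral_comp_sub_left (a := 0) (b := 1)
    (fun p : ℝ => p ^ b * (1 - p) ^ a * Real.log p) 1
  simp only [sub_sub_cancel, sub_self, sub_zero] at h
  rw [integral_pow_mul_one_sub_pow_mul_log, add_comm b a, mul_comm (b.factorial : ℝ)] at h
  rw [← h]
  simp_rw [mul_comm ((1 - _ : ℝ) ^ b)]

/-- The polynomial that `betaDensity n x` agrees with on `[0, 1]`. -/
noncomputable def betaPoly (n x : ℕ) (p : ℝ) : ℝ :=
  ((n : ℝ) + 1) * (n.choose x : ℝ) * p ^ x * (1 - p) ^ (n - x)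

lemma continuous_betaPoly (n x : ℕ) : Continuous (betaPoly n x) := by
  unfold betaPoly
  fun_prop

lemma betaDensity_eq_indicator (n x : ℕ) :
    betaDensity n x = (Set.Icc (0 : ℝ) 1).indicator (betaPoly n x) := by
  classical
  funext p
  simp only [betaDensity, betaPoly, Set.indicator, Set.mem_Icc]

lemma betaDensity_mul_log_eq_indicator (n x : ℕ) :
    (fun p => betaDensity n x p * Real.log (betaDensity n x p)) =
      (Set.Icc (0 : ℝ) 1).indicator (fun p => betaPoly n x p * Real.log (betaPoly n x p)) := by
  funext p
  rw [betaDensity_eq_indicator]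
  by_cases hp : p ∈ Set.Icc (0 : ℝ) 1 <;> simp [hp]

lemma integrable_betaDensity (n x : ℕ) : Integrable (betaDensity n x) := by
  rw [betaDensity_eq_indicator]
  exact (continuous_betaPoly n x).integrableOn_Icc.integrable_indicator measurableSet_Icc

lemma integrable_betaDensity_mul_log (n x : ℕ) :
    Integrable (fun p => betaDensity n x p * Real.log (betaDensity n x p)) := by
  rw [betaDensity_mul_log_eq_indicator]
  exact (continuous_mul_log.comp (continuous_betaPoly n x)).integrableOn_Icc.integrable_indicator
    measurableSet_Icc

lemma add_one_mul_choose {n x : ℕ} (hx : x ≤ n) :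
    ((n : ℝ) + 1) * n.choose x = (n + 1).factorial / (x.factorial * (n - x).factorial) := by
  rw [Nat.cast_choose ℝ hx, Nat.factorial_succ]
  push_cast
  ring

lemma diffEntropy_betaDensity {n x : ℕ} (hx : x ≤ n) :
    diffEntropy (betaDensity n x) =
      Real.log x.factorial + Real.log (n - x).factorial - Real.log (n + 1).factorial -
        x * harmonic x - (n - x : ℕ) * harmonic (n - x) + n * harmonic (n + 1) := by
  set C : ℝ := ((n : ℝ) + 1) * n.choose x with hC
  have hchoose : 0 < n.choose x := Nat.choose_pos hx
  have hCpos : 0 < C := by positivity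
  have h0 := integral_pow_mul_one_sub_pow x (n - x)
  have h1 := integral_pow_mul_one_sub_pow_mul_log x (n - x)
  have h2 := integral_pow_mul_one_sub_pow_mul_log_one_sub x (n - x)
  rw [Nat.add_sub_cancel' hx] at h0 h1 h2
  have hpoint : Set.EqOn (fun p => betaPoly n x p * Real.log (betaPoly n x p))
      (fun p => C * Real.log C * (p ^ x * (1 - p) ^ (n - x)) +
        C * x * (p ^ x * (1 - p) ^ (n - x) * Real.log p) +
        C * (n - x : ℕ) * (p ^ x * (1 - p) ^ (n - x) * Real.log (1 - p))) (Set.Ioo 0 1) := by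
    rintro p ⟨hp0, hp1⟩
    have hq : 0 < 1 - p := sub_pos.2 hp1
    simp only [betaPoly, ← hC]
    rw [Real.log_mul (by positivity) (by positivity), Real.log_mul (by positivity) (by positivity),
      Real.log_pow, Real.log_pow]
    ring
  have hint : ∫ p, betaDensity n x p * Real.log (betaDensity n x p) =
      Real.log C + x * (harmonic x - harmonic (n + 1)) +
        (n - x : ℕ) * (harmonic (n - x) - harmonic (n + 1)) := by
    rw [betaDensity_mul_log_eq_indicator, integral_indicator measurableSet_Icc,
      integral_Icc_eq_integral_Ioo, setIntegral_congr_fun measurableSet_Ioo hpoint,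
      ← integral_Ioc_eq_integral_Ioo, ← intervalIntegral.integral_of_le zero_le_one,
      intervalIntegral.integral_add, intervalIntegral.integral_add,
      intervalIntegral.integral_const_mul, intervalIntegral.integral_const_mul,
      intervalIntegral.integral_const_mul, h0, h1, h2, hC, add_one_mul_choose hx]
    · field_simp
    · exact Continuous.intervalIntegrable (by fun_prop) _ _
    · exact (intervalIntegrable_pow_mul_one_sub_pow_mul_log _ _).const_mul _
    · exact (Continuous.intervalIntegrable (by fun_prop) _ _).add
        ((intervalIntegrable_pow_mul_one_sub_pow_mul_log _ _).const_mul _)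
    · exact (intervalIntegrable_pow_mul_one_sub_pow_mul_log_one_sub _ _).const_mul _
  rw [diffEntropy, hint, hC, add_one_mul_choose hx, Real.log_div (by positivity) (by positivity),
    Real.log_mul (by positivity) (by positivity), Nat.cast_sub hx]
  ring

lemma diffEntropy_comp_affine {f : ℝ → ℝ} (hf : Integrable f)
    (hflog : Integrable (fun z => f z * Real.log (f z))) (hone : ∫ z, f z = 1) (a : ℝ) {c : ℝ}
    (hc : 0 < c) :
    diffEntropy (fun z => c * f (a + c * z)) = diffEntropy f - Real.log c := by
  have hpoint (z : ℝ) : c * f (a + c * z) * Real.log (c * f (a + c * z)) =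
      (fun y => c * (Real.log c * f y + f y * Real.log (f y))) (a + c * z) := by
    dsimp only
    rcases eq_or_ne (f (a + c * z)) 0 with h | h
    · simp [h]
    · rw [Real.log_mul hc.ne' h]
      ring
  have hcomp (g : ℝ → ℝ) : ∫ z, g (a + c * z) = c⁻¹ * ∫ z, g z := by
    rw [Measure.integral_comp_mul_left (fun y => g (a + y)) c, integral_add_left_eq_self,
      abs_of_pos (inv_pos.2 hc), smul_eq_mul]
  rw [diffEntropy, diffEntropy, integral_congr_ae (.of_forall hpoint),
    hcomp (fun y => c * (Real.log c * f y + f y * Real.log (f y))), integral_const_mul,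
    integral_add (hf.const_mul _) hflog, integral_const_mul, hone]
  field_simp
  ring

lemma diffEntropy_betaDensity_eq_logFactorialRemainder {n x : ℕ} (hx : x ≤ n) :
    diffEntropy (betaDensity n x) =
      logFactorialRemainder x + logFactorialRemainder (n - x) - logFactorialRemainder n +
        1 / 2 * (Real.log x + Real.log (n - x : ℕ) - Real.log n) - Real.log (n + 1) +
        n / ((n : ℝ) + 1) := by
  rw [diffEntropy_betaDensity hx, harmonic_succ, Nat.factorial_succ, Nat.cast_mul,
    Real.log_mul (by positivity) (by positivity)]
  simp only [logFactorialRemainder]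
  push_cast [Nat.cast_sub hx]
  ring

/-- If `x n / n → α ∈ (0, 1)`, then `h(f_{n, x n})` is asymptotic to the entropy of a Gaussian
of variance `α (1 - α) / n`. -/
theorem tendsto_diffEntropy_betaDensity_sub {α : ℝ} (hα : α ∈ Set.Ioo (0 : ℝ) 1) {x : ℕ → ℕ}
    (hxn : ∀ n, x n ≤ n) (hx : Tendsto (fun n => (x n : ℝ) / n) atTop (nhds α)) :
    Tendsto (fun n : ℕ => diffEntropy (betaDensity n (x n)) -
      (1 / 2) * Real.log (2 * π * exp 1 * α * (1 - α) / n)) atTop (nhds 0) := by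
  have hα0 : 0 < α := hα.1
  have hα1 : 0 < 1 - α := sub_pos.2 hα.2
  have hy : Tendsto (fun n => ((n - x n : ℕ) : ℝ) / n) atTop (nhds (1 - α)) := by
    refine (hx.const_sub 1).congr' ?_
    filter_upwards [eventually_gt_atTop 0] with n hn
    rw [Nat.cast_sub (hxn n)]
    field_simp
  have natTendsto {y : ℕ → ℕ} {β : ℝ} (hβ : 0 < β)
      (h : Tendsto (fun n => (y n : ℝ) / n) atTop (nhds β)) : Tendsto y atTop atTop := by
    rw [← tendsto_natCast_atTop_iff (R := ℝ)]
    refine (h.pos_mul_atTop hβ tendsto_natCast_atTop_atTop).congr' ?_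
    filter_upwards [eventually_gt_atTop 0] with n hn
    field_simp
  have hxtop := natTendsto hα0 hx
  have hytop := natTendsto hα1 hy
  have hfrac : Tendsto (fun n : ℕ => (n : ℝ) / ((n : ℝ) + 1)) atTop (nhds 1) :=
    tendsto_natCast_div_add_atTop 1
  have key := ((((tendsto_logFactorialRemainder.comp hxtop).add
    (tendsto_logFactorialRemainder.comp hytop)).sub tendsto_logFactorialRemainder).add
    (((hx.log hα0.ne').add (hy.log hα1.ne')).const_mul (1 / 2))).add
    ((hfrac.log one_ne_zero).add hfrac)
  have key' := key.sub_const (1 / 2 * (Real.log (2 * π) + 1 + Real.log α + Real.log (1 - α)))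
  convert key'.congr' ?_ using 2
  · rw [Real.log_one]
    ring
  · filter_upwards [eventually_gt_atTop 0, hxtop.eventually_gt_atTop 0,
      hytop.eventually_gt_atTop 0] with n hn hxpos hypos
    have hn' : (n : ℝ) ≠ 0 := by positivity
    have hx' : (x n : ℝ) ≠ 0 := by positivity
    have hy' : ((n - x n : ℕ) : ℝ) ≠ 0 := by positivity
    rw [diffEntropy_betaDensity_eq_logFactorialRemainder (hxn n), Real.log_div hx' hn',
      Real.log_div hy' hn', Real.log_div hn' (by positivity), Real.log_div (by positivity) hn',
      Real.log_mul (by positivity) hα1.ne', Real.log_mul (by positivity) hα0.ne',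
      Real.log_mul (by positivity) (exp_pos 1).ne', Real.log_exp]
    simp only [Function.comp]
    ring

lemma diffEntropy_tildeDensityAlpha {α : ℝ} (hα : α ∈ Set.Ioo (0 : ℝ) 1) {n : ℕ} (hn : 0 < n)
    (hx : Nat.floor (α * n) ≤ n) :
    diffEntropy (tildeDensityAlpha α n) = diffEntropy (betaDensity n (Nat.floor (α * n))) -
      (1 / 2) * Real.log (2 * π * exp 1 * α * (1 - α) / n) +
      (1 / 2) * Real.log (2 * π * exp 1) := by
  have hα0 : 0 < α := hα.1
  have hα1 : 0 < 1 - α := sub_pos.2 hα.2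
  have hσ : 0 < α * (1 - α) := mul_pos hα0 hα1
  have hn' : (0 : ℝ) < n := Nat.cast_pos.2 hn
  have hc : 0 < √(α * (1 - α)) / √n := div_pos (Real.sqrt_pos.2 hσ) (Real.sqrt_pos.2 hn')
  have h := diffEntropy_comp_affine (integrable_betaDensity n (Nat.floor (α * n)))
    (integrable_betaDensity_mul_log n _) (integral_betaDensity hx) α hc
  have e : 2 * π * exp 1 * α * (1 - α) / n = 2 * π * exp 1 * (α * (1 - α) / n) := by ring
  rw [← Real.sqrt_div hσ.le, Real.log_sqrt (by positivity)] at h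
  rw [e, Real.log_mul (by positivity) (by positivity)]
  unfold tildeDensityAlpha
  rw [← Real.sqrt_div hσ.le, h]
  ring

/-- For `α ∈ (0,1)` and `x_n = ⌊αn⌋`,
`h(f_{n,x_n}) - (1/2) log(2πe α(1-α)/n) → 0`; equivalently, the differential entropy of the
standardized variable converges to `(1/2) log (2πe)`. -/
theorem entropy_asymptotics_alpha (α : ℝ) (hα : α ∈ Set.Ioo (0 : ℝ) 1) :
    Tendsto (fun n : ℕ =>
        diffEntropy (betaDensity n (Nat.floor (α * n))) -
          (1 / 2) * Real.log (2 * Real.pi * Real.exp 1 * α * (1 - α) / n)) atTop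
      (nhds 0) ∧
    Tendsto (fun n : ℕ => diffEntropy (tildeDensityAlpha α n)) atTop
      (nhds ((1 / 2) * Real.log (2 * Real.pi * Real.exp 1))) := by
  have hle (n : ℕ) : Nat.floor (α * n) ≤ n :=
    Nat.floor_le_of_le (mul_le_of_le_one_left (Nat.cast_nonneg n) hα.2.le)
  have hlim := tendsto_diffEntropy_betaDensity_sub hα hle
    ((tendsto_nat_floor_mul_div_atTop hα.1.le).comp tendsto_natCast_atTop_atTop)
  refine ⟨hlim, ?_⟩
  have h := hlim.add_const ((1 / 2) * Real.log (2 * Real.pi * Real.exp 1))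
  rw [zero_add] at h
  refine h.congr' ?_
  filter_upwards [eventually_gt_atTop 0] with n hn
  exact (diffEntropy_tildeDensityAlpha hα hn (hle n)).symm
end

section
/- Fix α ∈ (0,1) and γ ∈ (0,1), and set x_n = ⌊αn⌋. Then the weighted Shannon entropy h^{φ}(f_{n,x_n}) = −∫₀¹ φ_n(p)·f_{n,x_n}(p)·log f_{n,x_n}(p) dp satisfies lim_{n→∞} [ h^{φ}(f_{n,x_n}) − (1/2)·log( 2πe·α(1−α)/n ) ] = (α−γ)²/( 2α(1−α) ). In particular, if α = γ the asymptotic coincides with that of the unweighted differential entropy. -/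
open MeasureTheory Real Filter

/-- The normalizing constant `Λ_n(γ)` of the weight function. -/
noncomputable def weightLambda (n x : ℕ) (γ : ℝ) : ℝ :=
  Real.Gamma ((x : ℝ) + 1) * Real.Gamma ((n : ℝ) - (x : ℝ) + 1) *
    Real.Gamma ((n : ℝ) + 2 + Real.sqrt n) /
  (Real.Gamma ((x : ℝ) + γ * Real.sqrt n + 1) *
    Real.Gamma ((n : ℝ) - (x : ℝ) + 1 + (1 - γ) * Real.sqrt n) *
    Real.Gamma ((n : ℝ) + 2))

/-- The weight function `φ_n(p) = Λ_n(γ) p^{γ√n} (1-p)^{(1-γ)√n}`. -/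
noncomputable def weightPhi (n x : ℕ) (γ : ℝ) (p : ℝ) : ℝ :=
  weightLambda n x γ * p ^ (γ * Real.sqrt n) * (1 - p) ^ ((1 - γ) * Real.sqrt n)

/-- Weighted Shannon differential entropy `h^φ(f) = -∫₀¹ φ f log f`. -/
noncomputable def weightedEntropy (n x : ℕ) (γ : ℝ) : ℝ :=
  -∫ p in Set.Ioo (0 : ℝ) 1,
    weightPhi n x γ p * betaDensity n x p * Real.log (betaDensity n x p)

lemma nonneg_of_hasDerivAt_of_sign {f f' : ℝ → ℝ} (hf : ∀ t, 0 < t → HasDerivAt f (f' t) t)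
    (h1 : f 1 = 0) (hneg : ∀ t, 0 < t → t ≤ 1 → f' t ≤ 0) (hpos : ∀ t, 1 ≤ t → 0 ≤ f' t)
    {t : ℝ} (ht : 0 < t) : 0 ≤ f t := by
  rcases le_total t 1 with h | h
  · have hanti : AntitoneOn f (Set.Icc t 1) := by
      refine antitoneOn_of_hasDerivWithinAt_nonpos (f' := f') (convex_Icc t 1)
        (fun y hy => (hf y (ht.trans_le hy.1)).continuousAt.continuousWithinAt) ?_ ?_
      · intro y hy
        rw [interior_Icc] at hy
        exact (hf y (ht.trans hy.1)).hasDerivWithinAt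
      · intro y hy
        rw [interior_Icc] at hy
        exact hneg y (ht.trans hy.1) hy.2.le
    rw [← h1]
    exact hanti ⟨le_rfl, h⟩ ⟨h, le_rfl⟩ h
  · have hmono : MonotoneOn f (Set.Icc 1 t) := by
      refine monotoneOn_of_hasDerivWithinAt_nonneg (f' := f') (convex_Icc 1 t)
        (fun y hy => (hf y (one_pos.trans_le hy.1)).continuousAt.continuousWithinAt) ?_ ?_
      · intro y hy
        rw [interior_Icc] at hy
        exact (hf y (one_pos.trans hy.1)).hasDerivWithinAt
      · intro y hy
        rw [interior_Icc] at hy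
        exact hpos y hy.1.le
    rw [← h1]
    exact hmono ⟨le_rfl, h⟩ ⟨h, le_rfl⟩ h

lemma log_le_cubic {t : ℝ} (ht : 0 < t) :
    Real.log t ≤ (t - 1) - (t - 1) ^ 2 / 2 + (t - 1) ^ 3 / 3 := by
  have h := nonneg_of_hasDerivAt_of_sign
    (f := fun t => (t - 1) - (t - 1) ^ 2 / 2 + (t - 1) ^ 3 / 3 - Real.log t)
    (f' := fun t => (t - 1) ^ 3 / t) ?_ (by simp) ?_ ?_ ht
  · linarith
  · intro y hy
    have hid := (hasDerivAt_id y).sub_const 1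
    convert! ((hid.sub ((hid.pow 2).div_const 2)).add ((hid.pow 3).div_const 3)).sub
      (Real.hasDerivAt_log hy.ne') using 1
    simp
    field_simp
    ring
  · intro y hy hy1
    exact div_nonpos_of_nonpos_of_nonneg (Odd.pow_nonpos (by decide) (by linarith)) hy.le
  · intro y hy
    have : 0 ≤ y - 1 := by linarith
    positivity

lemma cubic_le_log {t : ℝ} (ht : 0 < t) :
    (t - 1) - (t - 1) ^ 2 / 2 + (t - 1) ^ 3 / (3 * t) ≤ Real.log t := by
  have h := nonneg_of_hasDerivAt_of_sign
    (f := fun t => Real.log t - ((t - 1) - (t - 1) ^ 2 / 2 + (t - 1) ^ 3 / (3 * t)))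
    (f' := fun t => (t - 1) ^ 3 / (3 * t ^ 2)) ?_ (by simp) ?_ ?_ ht
  · linarith
  · intro y hy
    have hid := (hasDerivAt_id y).sub_const 1
    convert! (Real.hasDerivAt_log hy.ne').sub ((hid.sub ((hid.pow 2).div_const 2)).add
      ((hid.pow 3).div ((hasDerivAt_id y).const_mul 3) (by simpa using hy.ne'))) using 1
    simp
    field_simp
    ring
  · intro y hy hy1
    exact div_nonpos_of_nonpos_of_nonneg (Odd.pow_nonpos (by decide) (by linarith)) (by positivity)
  · intro y hy
    have : 0 ≤ y - 1 := by linarith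
    positivity

/-- The unnormalised beta density. -/
noncomputable def betaKernel (a b p : ℝ) : ℝ := p ^ (a - 1) * (1 - p) ^ (b - 1)

lemma betaKernel_nonneg (a b : ℝ) {p : ℝ} (hp : p ∈ Set.Ioo (0 : ℝ) 1) :
    0 ≤ betaKernel a b p :=
  mul_nonneg (Real.rpow_nonneg hp.1.le _) (Real.rpow_nonneg (by linarith [hp.2]) _)

lemma betaKernel_add_one (a b : ℝ) {p : ℝ} (hp : p ∈ Set.Ioo (0 : ℝ) 1) :
    betaKernel (a + 1) b p = p * betaKernel a b p := by
  have : p ^ (a + 1 - 1) = p ^ (a - 1) * p := by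
    rw [← Real.rpow_add_one hp.1.ne']
    ring_nf
  rw [betaKernel, betaKernel, this]
  ring

lemma integral_betaKernel {a b : ℝ} (ha : 0 < a) (hb : 0 < b) :
    ∫ p in Set.Ioo (0 : ℝ) 1, betaKernel a b p = ProbabilityTheory.beta a b := by
  have hB := ProbabilityTheory.beta_pos ha hb
  have h := ProbabilityTheory.lintegral_betaPDF_eq_one ha hb
  rw [ProbabilityTheory.lintegral_betaPDF, ← ENNReal.toReal_eq_one_iff,
    ← integral_eq_lintegral_of_nonneg_ae] at h
  · simp_rw [mul_assoc, integral_const_mul] at h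
    field_simp at h
    exact h
  · refine ae_restrict_of_forall_mem measurableSet_Ioo fun p hp => ?_
    have := betaKernel_nonneg a b hp
    rw [betaKernel] at this
    simp only [Pi.zero_apply, mul_assoc]
    positivity
  · exact Measurable.aestronglyMeasurable (by fun_prop)

lemma integrableOn_betaKernel {a b : ℝ} (ha : 0 < a) (hb : 0 < b) :
    IntegrableOn (betaKernel a b) (Set.Ioo 0 1) := by
  by_contra h
  have := integral_undef h
  rw [integral_betaKernel ha hb] at this
  exact (ProbabilityTheory.beta_pos ha hb).ne' this

lemma beta_add_one {a b : ℝ} (ha : 0 < a) (hb : 0 < b) :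
    ProbabilityTheory.beta (a + 1) b = a / (a + b) * ProbabilityTheory.beta a b := by
  have := (Real.Gamma_pos_of_pos (add_pos ha hb)).ne'
  have h2 : a + b ≠ 0 := by positivity
  rw [ProbabilityTheory.beta, ProbabilityTheory.beta, show a + 1 + b = a + b + 1 by ring,
    Real.Gamma_add_one ha.ne', Real.Gamma_add_one h2]
  field_simp

lemma integrableOn_betaKernel_mul_log {a b : ℝ} (ha : 1 < a) (hb : 0 < b) :
    IntegrableOn (fun p => betaKernel a b p * Real.log p) (Set.Ioo 0 1) := by
  refine Integrable.mono' (integrableOn_betaKernel (a := a - 1) (b := b) (by linarith) hb)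
    ?_ ?_
  · refine Measurable.aestronglyMeasurable ?_
    unfold betaKernel
    fun_prop
  · refine ae_restrict_of_forall_mem measurableSet_Ioo fun p hp => ?_
    have h := betaKernel_add_one (a - 1) b hp
    rw [sub_add_cancel] at h
    have hk := betaKernel_nonneg (a - 1) b hp
    have hl : Real.log p ≤ 0 := Real.log_nonpos hp.1.le hp.2.le
    have hl' := Real.one_sub_inv_le_log_of_pos hp.1
    have hpl : p * (-Real.log p) ≤ 1 := by
      have : p * (1 - p⁻¹) ≤ p * Real.log p := mul_le_mul_of_nonneg_left hl' hp.1.le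
      rw [mul_sub, mul_inv_cancel₀ hp.1.ne'] at this
      linarith [hp.1]
    rw [h, Real.norm_eq_abs, abs_mul, abs_of_nonpos hl, abs_of_nonneg (mul_nonneg hp.1.le hk)]
    nlinarith

/-- The expectation of `log p` under the beta distribution with parameters `a` and `b`. -/
noncomputable def betaLogMean (a b : ℝ) : ℝ :=
  (∫ p in Set.Ioo (0 : ℝ) 1, betaKernel a b p * Real.log p) / ProbabilityTheory.beta a b

lemma betaLogMean_le {a b : ℝ} (ha : 1 < a) (hb : 0 < b) :
    betaLogMean a b ≤ Real.log (a / (a + b)) - b / (2 * a * (a + b + 1)) +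
      2 * b * (b - a) / (3 * a ^ 2 * (a + b + 1) * (a + b + 2)) := by
  have ha0 : 0 < a := by linarith
  have hB := ProbabilityTheory.beta_pos ha0 hb
  set m := a / (a + b) with hm
  have hm0 : 0 < m := by positivity
  have i0 := integrableOn_betaKernel ha0 hb
  have i1 := integrableOn_betaKernel (a := a + 1) (by linarith) hb
  have i2 := integrableOn_betaKernel (a := a + 1 + 1) (by linarith) hb
  have i3 := integrableOn_betaKernel (a := a + 1 + 1 + 1) (by linarith) hb
  have j0 := i0.const_mul (Real.log m - 1 - 1 / 2 - 1 / 3)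
  have j1 := i1.const_mul (3 / m)
  have j2 := i2.const_mul (-(3 / 2) / m ^ 2)
  have j3 := i3.const_mul (1 / 3 / m ^ 3)
  have key : ∫ p in Set.Ioo (0 : ℝ) 1, betaKernel a b p * Real.log p ≤
      ∫ p in Set.Ioo (0 : ℝ) 1, ((Real.log m - 1 - 1 / 2 - 1 / 3) * betaKernel a b p +
        3 / m * betaKernel (a + 1) b p + -(3 / 2) / m ^ 2 * betaKernel (a + 1 + 1) b p +
        1 / 3 / m ^ 3 * betaKernel (a + 1 + 1 + 1) b p) := by
    refine setIntegral_mono_on (integrableOn_betaKernel_mul_log ha hb)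
      (((j0.fun_add j1).fun_add j2).fun_add j3) measurableSet_Ioo fun p hp => ?_
    have h := log_le_cubic (div_pos hp.1 hm0)
    rw [Real.log_div hp.1.ne' hm0.ne'] at h
    have h2 := mul_le_mul_of_nonneg_left h (betaKernel_nonneg a b hp)
    simp only [betaKernel_add_one _ _ hp]
    refine le_of_sub_nonneg ((sub_nonneg.2 h2).trans_eq ?_)
    field_simp
    ring
  rw [integral_add ((j0.fun_add j1).fun_add j2) j3, integral_add (j0.fun_add j1) j2, integral_add j0 j1] at key
  simp only [integral_const_mul] at key
  rw [integral_betaKernel ha0 hb, integral_betaKernel (by linarith) hb,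
    integral_betaKernel (by linarith) hb, integral_betaKernel (by linarith) hb,
    beta_add_one (a := a + 1 + 1) (by linarith) hb, beta_add_one (a := a + 1) (by linarith) hb,
    beta_add_one ha0 hb] at key
  rw [betaLogMean, div_le_iff₀ hB]
  refine key.trans_eq ?_
  have h1 : a + b ≠ 0 := by positivity
  have h2 : a + b + 1 ≠ 0 := by positivity
  have h3 : a + b + 2 ≠ 0 := by positivity
  generalize Real.log m = l
  rw [hm, show a + 1 + b = a + b + 1 by ring, show a + 1 + 1 + b = a + b + 2 by ring]
  field_simp
  ring

lemma le_betaLogMean {a b : ℝ} (ha : 1 < a) (hb : 0 < b) :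
    Real.log (a / (a + b)) - b / (2 * a * (a + b + 1)) -
      b * (a + b + a) / (3 * a * (a - 1) * (a + b) * (a + b + 1)) ≤ betaLogMean a b := by
  have ha0 : 0 < a := by linarith
  have hB := ProbabilityTheory.beta_pos ha0 hb
  set m := a / (a + b) with hm
  have hm0 : 0 < m := by positivity
  have i0 := integrableOn_betaKernel ha0 hb
  have i1 := integrableOn_betaKernel (a := a + 1) (by linarith) hb
  have i2 := integrableOn_betaKernel (a := a + 1 + 1) (by linarith) hb
  have i3 := integrableOn_betaKernel (a := a - 1) (by linarith) hb
  have j0 := i0.const_mul (Real.log m - 1 / 2)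
  have j1 := i1.const_mul (1 / m)
  have j2 := i2.const_mul (-(1 / 6) / m ^ 2)
  have j3 := i3.const_mul (-(1 / 3) * m)
  have key : ∫ p in Set.Ioo (0 : ℝ) 1, ((Real.log m - 1 / 2) * betaKernel a b p +
        1 / m * betaKernel (a + 1) b p + -(1 / 6) / m ^ 2 * betaKernel (a + 1 + 1) b p +
        -(1 / 3) * m * betaKernel (a - 1) b p) ≤
      ∫ p in Set.Ioo (0 : ℝ) 1, betaKernel a b p * Real.log p := by
    refine setIntegral_mono_on (((j0.fun_add j1).fun_add j2).fun_add j3)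
      (integrableOn_betaKernel_mul_log ha hb) measurableSet_Ioo fun p hp => ?_
    have h := cubic_le_log (div_pos hp.1 hm0)
    rw [Real.log_div hp.1.ne' hm0.ne'] at h
    have hk := betaKernel_add_one (a - 1) b hp
    rw [sub_add_cancel] at hk
    have h2 := mul_le_mul_of_nonneg_left h (betaKernel_nonneg a b hp)
    simp only [betaKernel_add_one _ _ hp]
    refine le_of_sub_nonneg ((sub_nonneg.2 h2).trans_eq ?_)
    rw [hk]
    have := hp.1
    field_simp
    ring
  rw [integral_add ((j0.fun_add j1).fun_add j2) j3, integral_add (j0.fun_add j1) j2, integral_add j0 j1] at key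
  simp only [integral_const_mul] at key
  have hs : 0 < a - 1 := by linarith
  have hs1 : 0 < a + b - 1 := by linarith
  have hbeta := beta_add_one hs hb
  rw [sub_add_cancel, show a - 1 + b = a + b - 1 by ring] at hbeta
  have hbeta' : ProbabilityTheory.beta (a - 1) b =
      (a + b - 1) / (a - 1) * ProbabilityTheory.beta a b := by
    rw [hbeta]
    field_simp
  rw [integral_betaKernel ha0 hb, integral_betaKernel (by linarith) hb,
    integral_betaKernel (by linarith) hb, integral_betaKernel (by linarith) hb,
    beta_add_one (a := a + 1) (by linarith) hb, beta_add_one ha0 hb, hbeta'] at key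
  rw [betaLogMean, le_div_iff₀ hB]
  refine Eq.trans_le ?_ key
  have h1 : a + b ≠ 0 := by positivity
  have h2 : a + b + 1 ≠ 0 := by positivity
  generalize Real.log m = l
  rw [hm, show a + 1 + b = a + b + 1 by ring]
  field_simp
  ring

lemma integrableOn_and_integral_betaKernel_mul_log_one_sub {a b : ℝ} (ha : 0 < a) (hb : 1 < b) :
    IntegrableOn (fun p => betaKernel a b p * Real.log (1 - p)) (Set.Ioo 0 1) ∧
    ∫ p in Set.Ioo (0 : ℝ) 1, betaKernel a b p * Real.log (1 - p) =
      ProbabilityTheory.beta a b * betaLogMean b a := by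
  have hB := (ProbabilityTheory.beta_pos ha (zero_lt_one.trans hb)).ne'
  have hcomm : ProbabilityTheory.beta b a = ProbabilityTheory.beta a b := by
    rw [ProbabilityTheory.beta, ProbabilityTheory.beta, mul_comm, add_comm]
  have hrefl : (fun p => betaKernel a b p * Real.log (1 - p)) =
      fun p => (fun q => betaKernel b a q * Real.log q) (1 - p) := by
    funext p
    simp only [betaKernel, sub_sub_cancel]
    ring
  have hi := integrableOn_betaKernel_mul_log hb ha
  constructor
  · rw [← intervalIntegrable_iff_integrableOn_Ioo_of_le zero_le_one] at hi ⊢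
    rw [hrefl]
    simpa using (hi.comp_sub_left 1).symm
  · rw [betaLogMean, hcomm, mul_div_cancel₀ _ hB, ← integral_Ioc_eq_integral_Ioo,
      ← integral_Ioc_eq_integral_Ioo, ← intervalIntegral.integral_of_le zero_le_one,
      ← intervalIntegral.integral_of_le zero_le_one, hrefl,
      intervalIntegral.integral_comp_sub_left (fun q => betaKernel b a q * Real.log q) 1]
    simp

lemma weightLambda_mul_choose {n x : ℕ} (hx : x ≤ n) (γ : ℝ) :
    weightLambda n x γ * (((n : ℝ) + 1) * (n.choose x : ℝ)) =
      (ProbabilityTheory.beta (x + (γ * √n + 1)) (n - x + ((1 - γ) * √n + 1)))⁻¹ := by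
  have h1 : (n.choose x : ℝ) * x.factorial * (n - x).factorial = n.factorial := by
    exact_mod_cast Nat.choose_mul_factorial_mul_factorial hx
  have h2 : Real.Gamma ((n : ℝ) + 2) = (n + 1) * n.factorial := by
    rw [show (n : ℝ) + 2 = (n + 1 : ℕ) + 1 by push_cast; ring, Real.Gamma_nat_eq_factorial,
      Nat.factorial_succ]
    push_cast
    ring
  have h3 : Real.Gamma ((n : ℝ) - x + 1) = (n - x).factorial := by
    rw [← Nat.cast_sub hx, Real.Gamma_nat_eq_factorial]
  rw [weightLambda, ProbabilityTheory.beta, h2, h3, Real.Gamma_nat_eq_factorial, ← h1,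
    show (x : ℝ) + (γ * √n + 1) = x + γ * √n + 1 by ring,
    show (n : ℝ) - x + ((1 - γ) * √n + 1) = n - x + 1 + (1 - γ) * √n by ring,
    show (x : ℝ) + γ * √n + 1 + (n - x + 1 + (1 - γ) * √n) = n + 2 + √n by ring]
  have hc : (n.choose x : ℝ) ≠ 0 := by exact_mod_cast (Nat.choose_pos hx).ne'
  have hf1 : (x.factorial : ℝ) ≠ 0 := by positivity
  have hf2 : ((n - x).factorial : ℝ) ≠ 0 := by positivity
  have hn : (n : ℝ) + 1 ≠ 0 := by positivity
  rw [inv_div, div_mul_eq_mul_div,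
    show (x.factorial : ℝ) * (n - x).factorial * Real.Gamma (n + 2 + √n) *
      ((n + 1) * n.choose x) = Real.Gamma (n + 2 + √n) *
      ((n + 1) * (n.choose x * x.factorial * (n - x).factorial)) by ring]
  exact mul_div_mul_right _ _ (by positivity)

lemma weightedEntropy_eq {n x : ℕ} (hn : 0 < n) (hx : x ≤ n) {γ : ℝ}
    (hγ : γ ∈ Set.Ioo (0 : ℝ) 1) :
    weightedEntropy n x γ = -(Real.log ((n + 1) * n.choose x) +
      x * betaLogMean (x + (γ * √n + 1)) (n - x + ((1 - γ) * √n + 1)) +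
      (n - x) * betaLogMean (n - x + ((1 - γ) * √n + 1)) (x + (γ * √n + 1))) := by
  have hr : 0 < √(n : ℝ) := Real.sqrt_pos.2 (by exact_mod_cast hn)
  have hxn : (x : ℝ) ≤ n := by exact_mod_cast hx
  have hΛ := weightLambda_mul_choose hx γ
  set a : ℝ := x + (γ * √n + 1) with ha
  set b : ℝ := n - x + ((1 - γ) * √n + 1) with hb
  have ha1 : 1 < a := by
    have := mul_pos hγ.1 hr
    have : (0 : ℝ) ≤ x := by positivity
    linarith
  have hb1 : 1 < b := by
    have := mul_pos (sub_pos.2 hγ.2) hr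
    linarith
  have ha0 : 0 < a := by linarith
  have hb0 : 0 < b := by linarith
  have hB := ProbabilityTheory.beta_pos ha0 hb0
  have hK : (0 : ℝ) < (n + 1) * n.choose x := by
    have : (0 : ℝ) < n.choose x := by exact_mod_cast Nat.choose_pos hx
    positivity
  obtain ⟨hi, he⟩ := integrableOn_and_integral_betaKernel_mul_log_one_sub ha0 hb1
  have j0 := (integrableOn_betaKernel ha0 hb0).const_mul (Real.log ((n + 1) * n.choose x))
  have j1 := (integrableOn_betaKernel_mul_log ha1 hb0).const_mul (x : ℝ)
  have j2 := hi.const_mul ((n : ℝ) - x)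
  have hcongr : ∫ p in Set.Ioo (0 : ℝ) 1,
      weightPhi n x γ p * betaDensity n x p * Real.log (betaDensity n x p) =
      ∫ p in Set.Ioo (0 : ℝ) 1, (ProbabilityTheory.beta a b)⁻¹ *
        (Real.log ((n + 1) * n.choose x) * betaKernel a b p +
          x * (betaKernel a b p * Real.log p) +
          (n - x) * (betaKernel a b p * Real.log (1 - p))) := by
    refine setIntegral_congr_fun measurableSet_Ioo fun p hp => ?_
    have hp0 := hp.1
    have hp1 : 0 < 1 - p := sub_pos.2 hp.2
    have e1 : p ^ (a - 1) = p ^ (γ * √n) * p ^ x := by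
      rw [← Real.rpow_add_natCast hp0.ne', ha]
      ring_nf
    have e2 : (1 - p) ^ (b - 1) = (1 - p) ^ ((1 - γ) * √n) * (1 - p) ^ (n - x) := by
      rw [← Real.rpow_add_natCast hp1.ne', hb, Nat.cast_sub hx]
      ring_nf
    have hlog : Real.log ((n + 1) * n.choose x * p ^ x * (1 - p) ^ (n - x)) =
        Real.log ((n + 1) * n.choose x) + x * Real.log p + (n - x) * Real.log (1 - p) := by
      rw [Real.log_mul (by positivity) (by positivity),
        Real.log_mul (by positivity) (by positivity), Real.log_pow, Real.log_pow, Nat.cast_sub hx]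
    simp only [betaDensity, if_pos (And.intro hp.1.le hp.2.le), hlog, weightPhi, betaKernel,
      e1, e2, ← hΛ]
    ring
  rw [weightedEntropy, hcongr, integral_const_mul, integral_add (j0.fun_add j1) j2,
    integral_add j0 j1, integral_const_mul, integral_const_mul, integral_const_mul, he,
    integral_betaKernel ha0 hb0]
  rw [show ∫ p in Set.Ioo (0 : ℝ) 1, betaKernel a b p * Real.log p =
    ProbabilityTheory.beta a b * betaLogMean a b by
      rw [betaLogMean, mul_div_cancel₀ _ hB.ne']]
  field_simp

lemma tendsto_mul_betaLogMean_sub {a b y : ℕ → ℝ} {A B Y : ℝ} (hA : 0 < A) (hB : 0 < B)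
    (hY : 0 < Y) (ha : Tendsto (fun n : ℕ => a n / n) atTop (nhds A))
    (hb : Tendsto (fun n : ℕ => b n / n) atTop (nhds B))
    (hy : Tendsto (fun n : ℕ => y n / n) atTop (nhds Y)) :
    Tendsto (fun n => y n * (betaLogMean (a n) (b n) - Real.log (a n / (a n + b n)))) atTop
      (nhds (-(Y * B / (2 * A * (A + B))))) := by
  have hinv : Tendsto (fun n : ℕ => 1 / (n : ℝ)) atTop (nhds 0) := tendsto_one_div_atTop_nhds_zero_nat
  have ha1 : Tendsto (fun n : ℕ => (a n - 1) / n) atTop (nhds A) := by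
    simpa [sub_div] using ha.sub hinv
  have hs : Tendsto (fun n : ℕ => (a n + b n) / n) atTop (nhds (A + B)) := by
    simpa [add_div] using ha.add hb
  have hs1 : Tendsto (fun n : ℕ => (a n + b n + 1) / n) atTop (nhds (A + B)) := by
    simpa [add_div] using hs.add hinv
  have hs2 : Tendsto (fun n : ℕ => (a n + b n + 2) / n) atTop (nhds (A + B)) := by
    simpa [add_div, div_eq_mul_inv, add_mul] using hs.add (hinv.const_mul 2)
  have hmain : Tendsto (fun n : ℕ => (y n / n) * (b n / n) /
      (2 * (a n / n) * ((a n + b n + 1) / n))) atTop (nhds (Y * B / (2 * A * (A + B)))) :=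
    (hy.mul hb).div ((ha.const_mul 2).mul hs1) (by positivity)
  have hup : Tendsto (fun n : ℕ => 1 / (n : ℝ) * ((y n / n) * (2 * (b n / n) * (b n / n - a n / n)) /
      (3 * (a n / n) ^ 2 * ((a n + b n + 1) / n) * ((a n + b n + 2) / n)))) atTop
      (nhds (0 * (Y * (2 * B * (B - A)) / (3 * A ^ 2 * (A + B) * (A + B))))) :=
    hinv.mul ((hy.mul ((hb.const_mul 2).mul (hb.sub ha))).div
      ((((ha.pow 2).const_mul 3).mul hs1).mul hs2) (by positivity))
  have hlo : Tendsto (fun n : ℕ => 1 / (n : ℝ) * ((y n / n) * ((b n / n) *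
      ((a n + b n) / n + a n / n)) / (3 * (a n / n) * ((a n - 1) / n) * ((a n + b n) / n) *
      ((a n + b n + 1) / n)))) atTop
      (nhds (0 * (Y * (B * (A + B + A)) / (3 * A * A * (A + B) * (A + B))))) :=
    hinv.mul ((hy.mul (hb.mul (hs.add ha))).div
      ((((ha.const_mul 3).mul ha1).mul hs).mul hs1) (by positivity))
  have hU := hmain.neg.add hup
  have hL := hmain.neg.sub hlo
  rw [zero_mul, add_zero] at hU
  rw [zero_mul, sub_zero] at hL
  have hev : ∀ᶠ n : ℕ in atTop, 0 < (n : ℝ) ∧ 1 < a n ∧ 0 < b n ∧ 0 < y n := by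
    filter_upwards [eventually_gt_atTop 0, ha1.eventually_const_lt hA, hb.eventually_const_lt hB,
      hy.eventually_const_lt hY] with n hn h1 h2 h3
    have hn' : (0 : ℝ) < n := by exact_mod_cast hn
    rw [lt_div_iff₀ hn', zero_mul] at h1 h2 h3
    exact ⟨hn', by linarith, h2, h3⟩
  refine tendsto_of_tendsto_of_tendsto_of_le_of_le' hL hU ?_ ?_
  · filter_upwards [hev] with n ⟨hn, h1, h2, h3⟩
    have h := mul_le_mul_of_nonneg_left (sub_le_sub_right (le_betaLogMean h1 h2)
      (Real.log (a n / (a n + b n)))) h3.le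
    refine Eq.trans_le ?_ h
    have h0 : a n ≠ 0 := by linarith
    have h0' : a n - 1 ≠ 0 := by linarith
    have : a n + b n ≠ 0 := by linarith
    have : a n + b n + 1 ≠ 0 := by linarith
    field_simp
    ring
  · filter_upwards [hev] with n ⟨hn, h1, h2, h3⟩
    have h := mul_le_mul_of_nonneg_left (sub_le_sub_right (betaLogMean_le h1 h2)
      (Real.log (a n / (a n + b n)))) h3.le
    refine h.trans_eq ?_
    have h0 : a n ≠ 0 := by linarith
    have : a n + b n + 1 ≠ 0 := by linarith
    have : a n + b n + 2 ≠ 0 := by linarith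
    field_simp
    ring

lemma tendsto_mul_log_one_add_div_sub {y c : ℕ → ℝ} {L : ℝ} (hy : ∀ᶠ n in atTop, 0 < y n)
    (hc : Tendsto (fun n => c n / y n) atTop (nhds 0))
    (hL : Tendsto (fun n => c n ^ 2 / y n) atTop (nhds L)) :
    Tendsto (fun n => y n * Real.log (1 + c n / y n) - c n) atTop (nhds (-(L / 2))) := by
  have hU := (hL.div_const 2).neg.add ((hL.mul hc).div_const 3)
  have hl := (hL.div_const 2).neg.add ((hL.mul hc).div ((hc.const_add 1).const_mul 3) (by simp))
  simp only [mul_zero, zero_div, add_zero] at hU hl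
  have hev := (hc.const_add 1).eventually_const_lt (u := 0) (by simp)
  refine tendsto_of_tendsto_of_tendsto_of_le_of_le' hl hU ?_ ?_
  · filter_upwards [hy, hev] with n h1 h2
    have h := mul_le_mul_of_nonneg_left (cubic_le_log h2) h1.le
    refine le_of_sub_nonneg ((sub_nonneg.2 h).trans_eq ?_)
    simp only [Pi.div_apply]
    generalize Real.log _ = l
    rw [add_sub_cancel_left]
    field_simp
    ring
  · filter_upwards [hy, hev] with n h1 h2
    have h := mul_le_mul_of_nonneg_left (log_le_cubic h2) h1.le
    refine le_of_sub_nonneg ((sub_nonneg.2 h).trans_eq ?_)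
    generalize Real.log _ = l
    rw [add_sub_cancel_left]
    field_simp
    ring

lemma log_factorial_eq {n : ℕ} (hn : 0 < n) :
    Real.log n.factorial = Real.log (Stirling.stirlingSeq n) +
      1 / 2 * (Real.log 2 + Real.log n) + n * (Real.log n - 1) := by
  have hn' : (n : ℝ) ≠ 0 := by positivity
  rw [Stirling.log_stirlingSeq_formula, Real.log_mul two_ne_zero hn',
    Real.log_div hn' (Real.exp_ne_zero 1), Real.log_exp]
  ring

lemma log_choose_eq {n x : ℕ} (hx : 0 < x) (hxn : x < n) :
    Real.log (n.choose x) = Real.log (Stirling.stirlingSeq n) -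
      Real.log (Stirling.stirlingSeq x) - Real.log (Stirling.stirlingSeq (n - x)) -
      1 / 2 * (Real.log 2 + Real.log (x / n) + Real.log ((n - x) / n) + Real.log n) -
      x * Real.log (x / n) - (n - x) * Real.log ((n - x) / n) := by
  have h1 : (n.choose x : ℝ) * x.factorial * (n - x).factorial = n.factorial := by
    exact_mod_cast Nat.choose_mul_factorial_mul_factorial hxn.le
  have hn0 : (n : ℝ) ≠ 0 := by exact_mod_cast (hx.trans hxn).ne'
  have hx0 : (x : ℝ) ≠ 0 := by positivity
  have hnx : (n : ℝ) - x ≠ 0 := sub_ne_zero.2 (by exact_mod_cast hxn.ne')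
  have hc : (n.choose x : ℝ) ≠ 0 := by exact_mod_cast (Nat.choose_pos hxn.le).ne'
  have h2 := congrArg Real.log h1
  rw [Real.log_mul (by positivity) (by positivity), Real.log_mul hc (by positivity),
    log_factorial_eq hx, log_factorial_eq (hx.trans hxn), log_factorial_eq (Nat.sub_pos_of_lt hxn),
    Nat.cast_sub hxn.le] at h2
  rw [Real.log_div hx0 hn0, Real.log_div hnx hn0]
  linear_combination h2

lemma tendsto_log_choose_add {x : ℕ → ℕ} {α : ℝ} (hα : α ∈ Set.Ioo (0 : ℝ) 1)
    (hx : Tendsto (fun n : ℕ => (x n : ℝ) / n) atTop (nhds α)) :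
    Tendsto (fun n : ℕ => Real.log ((n + 1) * n.choose (x n)) +
      x n * Real.log (x n / n) + (n - x n) * Real.log ((n - x n) / n) +
      1 / 2 * Real.log (2 * Real.pi * Real.exp 1 * α * (1 - α) / n)) atTop (nhds (1 / 2)) := by
  have hα0 := hα.1
  have hα1 : 0 < 1 - α := sub_pos.2 hα.2
  have hy : Tendsto (fun n : ℕ => ((n : ℝ) - x n) / n) atTop (nhds (1 - α)) := by
    refine (hx.const_sub 1).congr' ?_
    filter_upwards [eventually_gt_atTop 0] with n hn
    have : (n : ℝ) ≠ 0 := by positivity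
    field_simp
  have hev : ∀ᶠ n : ℕ in atTop, 0 < n ∧ 0 < x n ∧ x n < n := by
    filter_upwards [eventually_gt_atTop 0, hx.eventually_const_lt hα0,
      hy.eventually_const_lt hα1] with n hn h1 h2
    have hn' : (0 : ℝ) < n := by exact_mod_cast hn
    rw [lt_div_iff₀ hn', zero_mul] at h1 h2
    exact ⟨hn, by exact_mod_cast h1, by exact_mod_cast sub_pos.1 h2⟩
  have hxtop : Tendsto x atTop atTop := by
    rw [← tendsto_natCast_atTop_iff (R := ℝ)]
    refine (hx.pos_mul_atTop hα0 tendsto_natCast_atTop_atTop).congr' ?_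
    filter_upwards [eventually_gt_atTop 0] with n hn
    field_simp
  have hytop : Tendsto (fun n => n - x n) atTop atTop := by
    rw [← tendsto_natCast_atTop_iff (R := ℝ)]
    refine (hy.pos_mul_atTop hα1 tendsto_natCast_atTop_atTop).congr' ?_
    filter_upwards [hev] with n ⟨hn, h1, h2⟩
    rw [Nat.cast_sub h2.le]
    field_simp
  have hst : Tendsto (fun n => Real.log (Stirling.stirlingSeq n)) atTop (nhds (Real.log (√π))) :=
    Stirling.tendsto_stirlingSeq_sqrt_pi.log (by positivity)
  have hsucc : Tendsto (fun n : ℕ => Real.log (1 + 1 / (n : ℝ))) atTop (nhds 0) := by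
    have h := (tendsto_one_div_atTop_nhds_zero_nat (𝕜 := ℝ)).const_add 1
    simpa using h.log (by simp)
  have hlim := (((((hsucc.add hst).sub (hst.comp hxtop)).sub (hst.comp hytop)).sub
    ((hx.log hα0.ne').const_mul (1 / 2))).sub ((hy.log hα1.ne').const_mul (1 / 2))).add_const
    (1 / 2 * (Real.log π + Real.log α + Real.log (1 - α) + 1))
  refine (hlim.congr' ?_).trans_eq ?_
  · filter_upwards [hev] with n ⟨hn, h1, h2⟩
    have hn' : (n : ℝ) ≠ 0 := by positivity
    have hc : (n.choose (x n) : ℝ) ≠ 0 := by exact_mod_cast (Nat.choose_pos h2.le).ne'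
    have hexp := Real.exp_ne_zero 1
    have hpi := Real.pi_ne_zero
    rw [Real.log_mul (by positivity) hc, log_choose_eq h1 h2,
      Real.log_div (x := 2 * π * rexp 1 * α * (1 - α)) (by positivity) hn',
      Real.log_mul (by positivity) hα1.ne', Real.log_mul (by positivity) hα0.ne',
      Real.log_mul (by positivity) hexp, Real.log_mul two_ne_zero hpi, Real.log_exp,
      show 1 + 1 / (n : ℝ) = (n + 1) / n by field_simp, Real.log_div (by positivity) hn']
    simp only [Function.comp_apply]
    ring
  · congr 1
    rw [Real.log_sqrt Real.pi_pos.le]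
    ring

/-- For `α, γ ∈ (0,1)` and `x_n = ⌊αn⌋`, the weighted Shannon entropy satisfies
`h^φ(f_{n,x_n}) - (1/2) log(2πe α(1-α)/n) → (α-γ)²/(2α(1-α))`. -/
theorem weighted_entropy_asymptotics
    (α γ : ℝ) (hα : α ∈ Set.Ioo (0 : ℝ) 1) (hγ : γ ∈ Set.Ioo (0 : ℝ) 1) :
    Tendsto (fun n : ℕ =>
        weightedEntropy n (Nat.floor (α * n)) γ -
          (1 / 2) * Real.log (2 * Real.pi * Real.exp 1 * α * (1 - α) / n)) atTop
      (nhds ((α - γ) ^ 2 / (2 * α * (1 - α)))) := by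
  have hα0 := hα.1
  have hα1 : 0 < 1 - α := sub_pos.2 hα.2
  set x : ℕ → ℕ := fun n => Nat.floor (α * n)
  have hx : Tendsto (fun n : ℕ => (x n : ℝ) / n) atTop (nhds α) :=
    (tendsto_nat_floor_mul_div_atTop hα0.le).comp tendsto_natCast_atTop_atTop
  have hy : Tendsto (fun n : ℕ => ((n : ℝ) - x n) / n) atTop (nhds (1 - α)) := by
    refine (hx.const_sub 1).congr' ?_
    filter_upwards [eventually_gt_atTop 0] with n hn
    have : (n : ℝ) ≠ 0 := by positivity
    field_simp
  have hsqrt : Tendsto (fun n : ℕ => 1 / √(n : ℝ)) atTop (nhds 0) := by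
    have h := Real.tendsto_sqrt_atTop.comp (tendsto_natCast_atTop_atTop (R := ℝ))
    simp only [one_div]
    exact h.inv_tendsto_atTop
  have hlin : ∀ k l : ℝ, Tendsto (fun n : ℕ => (k * √(n : ℝ) + l) / n) atTop (nhds 0) := by
    intro k l
    have h := (hsqrt.const_mul k).add ((hsqrt.pow 2).const_mul l)
    simp only [mul_zero, ne_eq, OfNat.ofNat_ne_zero, not_false_eq_true, zero_pow, add_zero] at h
    refine h.congr' ?_
    filter_upwards [eventually_gt_atTop 0] with n hn
    have hs : 0 < √(n : ℝ) := Real.sqrt_pos.2 (by exact_mod_cast hn)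
    have hsq := Real.sq_sqrt (Nat.cast_nonneg (α := ℝ) n)
    nth_rewrite 4 [← hsq]
    field_simp
  have hquad : ∀ k l : ℝ,
      Tendsto (fun n : ℕ => (k * √(n : ℝ) + l) ^ 2 / n) atTop (nhds (k ^ 2)) := by
    intro k l
    have h := ((hsqrt.const_mul l).const_add k).pow 2
    simp only [mul_zero, add_zero] at h
    refine h.congr' ?_
    filter_upwards [eventually_gt_atTop 0] with n hn
    have hs : 0 < √(n : ℝ) := Real.sqrt_pos.2 (by exact_mod_cast hn)
    have hsq := Real.sq_sqrt (Nat.cast_nonneg (α := ℝ) n)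
    nth_rewrite 3 [← hsq]
    field_simp
  have hlogterm : ∀ {y : ℕ → ℝ} {Y : ℝ} (k l : ℝ), 0 < Y →
      Tendsto (fun n : ℕ => y n / n) atTop (nhds Y) →
      Tendsto (fun n : ℕ => y n * Real.log (1 + (k * √(n : ℝ) + l) / y n) - (k * √(n : ℝ) + l))
        atTop (nhds (-(k ^ 2 / Y / 2))) := by
    intro y Y k l hY hyY
    refine tendsto_mul_log_one_add_div_sub ?_ ?_ ?_
    · filter_upwards [eventually_gt_atTop 0, hyY.eventually_const_lt hY] with n hn h
      have hn' : (0 : ℝ) < n := by exact_mod_cast hn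
      rwa [lt_div_iff₀ hn', zero_mul] at h
    · have h := (hlin k l).div hyY hY.ne'
      rw [zero_div] at h
      refine h.congr' ?_
      filter_upwards [eventually_gt_atTop 0] with n hn
      exact div_div_div_cancel_right₀ (by positivity) _ _
    · refine ((hquad k l).div hyY hY.ne').congr' ?_
      filter_upwards [eventually_gt_atTop 0] with n hn
      exact div_div_div_cancel_right₀ (by positivity) _ _
  have t1 := hlogterm γ 1 hα0 hx
  have t2 := hlogterm (1 - γ) 1 hα1 hy
  have t3 := hlogterm (y := fun n => n) 1 2 one_pos (by
    refine tendsto_const_nhds.congr' ?_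
    filter_upwards [eventually_gt_atTop 0] with n hn
    exact (div_self (by positivity)).symm)
  have ha : Tendsto (fun n : ℕ => ((x n : ℝ) + (γ * √n + 1)) / n) atTop (nhds α) := by
    simpa [add_div] using hx.add (hlin γ 1)
  have hb : Tendsto (fun n : ℕ => ((n : ℝ) - x n + ((1 - γ) * √n + 1)) / n) atTop
      (nhds (1 - α)) := by
    have h := hy.add (hlin (1 - γ) 1)
    simp only [← add_div, add_zero] at h
    exact h
  have m1 := tendsto_mul_betaLogMean_sub hα0 hα1 hα0 ha hb hx
  have m2 := tendsto_mul_betaLogMean_sub hα1 hα0 hα1 hb ha hy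
  have hlim := ((tendsto_log_choose_add hα hx).add (m1.add m2)).add ((t1.add t2).sub t3)
  refine (hlim.neg.congr' ?_).trans_eq ?_
  · filter_upwards [eventually_gt_atTop 0, hx.eventually_const_lt hα0,
      hy.eventually_const_lt hα1] with n hn h1 h2
    have hn' : (0 : ℝ) < n := by exact_mod_cast hn
    rw [lt_div_iff₀ hn', zero_mul] at h1 h2
    have hxn : x n ≤ n := by exact_mod_cast (sub_pos.1 h2).le
    have hr : 0 < √(n : ℝ) := Real.sqrt_pos.2 hn'
    have hc := mul_pos hγ.1 hr
    have hd := mul_pos (sub_pos.2 hγ.2) hr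
    have hlog : ∀ {y c : ℝ}, 0 < y → 0 < c →
        Real.log ((y + c) / (n + (1 * √n + 2))) =
          Real.log (y / n) + Real.log (1 + c / y) - Real.log (1 + (1 * √n + 2) / n) := by
      intro y c hy hc
      rw [← Real.log_mul (by positivity) (by positivity),
        ← Real.log_div (by positivity) (by positivity)]
      congr 1
      field_simp
    rw [weightedEntropy_eq hn hxn hγ,
      show (x n : ℝ) + (γ * √n + 1) + (n - x n + ((1 - γ) * √n + 1)) = n + (1 * √n + 2) by ring,
      show (n : ℝ) - x n + ((1 - γ) * √n + 1) + (x n + (γ * √n + 1)) = n + (1 * √n + 2) by ring,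
      hlog h1 (by linarith), hlog h2 (by linarith)]
    ring
  · congr 1
    field_simp
    ring
end

section
/- Let (x_n) be a sequence of integers with 0 ≤ x_n ≤ n, x_n → ∞ and n − x_n → ∞ as n → ∞, and let ν > 0, ν ≠ 1. Then the Rényi entropy H_ν(f_{n,x_n}) = (1−ν)^{−1}·log ∫₀¹ ( f_{n,x_n}(p) )^ν dp satisfies lim_{n→∞} [ H_ν(f_{n,x_n}) − (1/2)·log( 2π·x_n·(n−x_n)/n³ ) ] = − log(ν) / ( 2(1−ν) ). -/
open MeasureTheory Real Filter

/-- Rényi entropy of order `ν`: `H_ν(f) = (1-ν)⁻¹ log ∫₀¹ f^ν`. -/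
noncomputable def renyiEntropy (ν : ℝ) (n x : ℕ) : ℝ :=
  (1 - ν)⁻¹ * Real.log (∫ p in Set.Ioo (0 : ℝ) 1, betaDensity n x p ^ ν)

/-- The error term in Stirling's approximation to `log Γ(z + 1)`. -/
noncomputable def stirlingError (z : ℝ) : ℝ :=
  log (Gamma (z + 1)) - (z * log z - z + 1 / 2 * log (2 * π * z))

theorem tendsto_stirlingError_natCast :
    Tendsto (fun n : ℕ => stirlingError n) atTop (nhds 0) := by
  have h : Tendsto (fun n : ℕ => log (Stirling.stirlingSeq n) - log (√π)) atTop (nhds 0) := by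
    simpa using ((continuousAt_log (by positivity : √π ≠ 0)).tendsto.comp
      Stirling.tendsto_stirlingSeq_sqrt_pi).sub_const (log (√π))
  refine h.congr' ?_
  filter_upwards [eventually_gt_atTop 0] with n hn
  have hn' : (0 : ℝ) < n := by exact_mod_cast hn
  rw [Stirling.log_stirlingSeq_formula, stirlingError, Gamma_nat_eq_factorial,
    log_sqrt pi_pos.le, log_div hn'.ne' (exp_pos 1).ne', log_exp,
    log_mul two_ne_zero hn'.ne', log_mul (by positivity) hn'.ne',
    log_mul two_ne_zero pi_ne_zero]
  ring

theorem abs_stirlingError_sub_le {n : ℕ} (hn : 0 < n) {t : ℝ} (ht0 : 0 < t) (ht1 : t ≤ 1) :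
    |stirlingError (n + t) - stirlingError n| ≤ 2 / n := by
  have hn' : (0 : ℝ) < n := by exact_mod_cast hn
  have hz : 0 < (n : ℝ) + t := by positivity
  have feq : ∀ {y : ℝ}, 0 < y → (log ∘ Gamma) (y + 1) = (log ∘ Gamma) y + log y := by
    intro y hy
    simp only [Function.comp_apply]
    rw [Gamma_add_one hy.ne', log_mul hy.ne' (Gamma_pos_of_pos hy).ne', add_comm]
  have upper := BohrMollerup.f_add_nat_le convexOn_log_Gamma feq n.succ_ne_zero ht0 ht1
  have lower := BohrMollerup.f_add_nat_ge convexOn_log_Gamma feq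
    (show 2 ≤ n + 1 by omega) ht0
  simp only [Function.comp_apply, Nat.succ_eq_add_one, Nat.cast_add, Nat.cast_one,
    add_sub_cancel_right] at upper lower
  rw [show (n : ℝ) + 1 + t = n + t + 1 by ring] at upper lower
  have log_succ : log ((n : ℝ) + 1) - log n ≤ 1 / n := by
    rw [← log_div (by positivity) hn'.ne']
    refine (log_le_sub_one_of_pos (by positivity)).trans_eq ?_
    field_simp
    ring
  have log_succ_nonneg : log n ≤ log ((n : ℝ) + 1) := log_le_log hn' (by linarith)
  have ratio_upper : log (n + t) - log n ≤ t / n := by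
    rw [← log_div hz.ne' hn'.ne']
    refine (log_le_sub_one_of_pos (by positivity)).trans_eq ?_
    field_simp
    ring
  have ratio_lower : t / (n + t) ≤ log (n + t) - log n := by
    rw [← log_div hz.ne' hn'.ne']
    refine Eq.trans_le ?_ (one_sub_inv_le_log_of_pos (by positivity))
    field_simp
    ring
  have div_le : t / n ≤ 1 / n := by gcongr
  have ratio_nonneg : 0 ≤ log (n + t) - log n := le_trans (by positivity) ratio_lower
  have main_upper : (n + t) * (log (n + t) - log n) ≤ t + 1 / n := by
    calc (n + t) * (log (n + t) - log n) ≤ (n + t) * (t / n) := by gcongr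
      _ = t + t ^ 2 / n := by field_simp
      _ ≤ t + 1 / n := by gcongr; nlinarith
  have main_lower : t ≤ (n + t) * (log (n + t) - log n) := by
    calc t = (n + t) * (t / (n + t)) := by field_simp
      _ ≤ _ := by gcongr
  have step_upper : t * (log ((n : ℝ) + 1) - log n) ≤ 1 / n := by
    nlinarith
  have two_div : (2 : ℝ) / n = 1 / n + 1 / n := by ring
  rw [stirlingError, stirlingError, log_mul (by positivity) hz.ne',
    log_mul (by positivity) hn'.ne', abs_le]
  constructor <;> nlinarith

theorem tendsto_stirlingError : Tendsto stirlingError atTop (nhds 0) := by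
  have floor_top : Tendsto (fun z : ℝ => ⌊z⌋₊) atTop atTop := tendsto_nat_floor_atTop
  have h0 : Tendsto (fun z : ℝ => stirlingError ⌊z⌋₊) atTop (nhds 0) :=
    tendsto_stirlingError_natCast.comp floor_top
  have h1 : Tendsto (fun z : ℝ => stirlingError z - stirlingError ⌊z⌋₊) atTop (nhds 0) := by
    refine squeeze_zero_norm' ?_
      ((tendsto_const_div_atTop_nhds_zero_nat (2 : ℝ)).comp floor_top)
    filter_upwards [eventually_ge_atTop 1] with z hz
    have hn : 0 < ⌊z⌋₊ := Nat.floor_pos.2 hz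
    rcases (Nat.floor_le (zero_le_one.trans hz)).eq_or_lt with h | h
    · rw [h, sub_self, norm_zero]
      exact div_nonneg zero_le_two (Nat.cast_nonneg _)
    · have := abs_stirlingError_sub_le hn (sub_pos.2 h)
        (by linarith [Nat.lt_floor_add_one z])
      rwa [add_sub_cancel] at this
  simpa using h1.add h0

theorem integral_rpow_mul_one_sub_rpow {α β : ℝ} (hα : 0 < α) (hβ : 0 < β) :
    ∫ p in Set.Ioo (0 : ℝ) 1, p ^ (α - 1) * (1 - p) ^ (β - 1) = ProbabilityTheory.beta α β := by
  have hb := ProbabilityTheory.beta_pos hα hβ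
  have h := ProbabilityTheory.lintegral_betaPDF_eq_one hα hβ
  rw [ProbabilityTheory.lintegral_betaPDF] at h
  have hi : ∫ p in Set.Ioo (0 : ℝ) 1,
      1 / ProbabilityTheory.beta α β * p ^ (α - 1) * (1 - p) ^ (β - 1) = 1 := by
    rw [integral_eq_lintegral_of_nonneg_ae, h, ENNReal.toReal_one]
    · filter_upwards [ae_restrict_mem measurableSet_Ioo] with p hp
      have := hp.1
      have : 0 < 1 - p := sub_pos.2 hp.2
      simp only [Pi.zero_apply]
      positivity
    · exact Measurable.aestronglyMeasurable (by fun_prop)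
  simp_rw [mul_assoc] at hi
  rw [integral_const_mul] at hi
  field_simp at hi
  exact hi

theorem integral_betaDensity_rpow {n x : ℕ} (hx : x ≤ n) {ν : ℝ} (hν : 0 < ν) :
    ∫ p in Set.Ioo (0 : ℝ) 1, betaDensity n x p ^ ν =
      (((n : ℝ) + 1) * n.choose x) ^ ν *
        ProbabilityTheory.beta (ν * x + 1) (ν * ((n : ℝ) - x) + 1) := by
  have hxn : (x : ℝ) ≤ n := by exact_mod_cast hx
  rw [← integral_rpow_mul_one_sub_rpow (by positivity)
    (by have := mul_nonneg hν.le (sub_nonneg.2 hxn); linarith), ← integral_const_mul]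
  refine setIntegral_congr_fun measurableSet_Ioo fun p hp => ?_
  have h0 : 0 < p := hp.1
  have h1 : 0 < 1 - p := sub_pos.2 hp.2
  simp only [betaDensity, if_pos (And.intro hp.1.le hp.2.le), add_sub_cancel_right]
  rw [mul_rpow (by positivity) (by positivity), mul_rpow (by positivity) (by positivity),
    ← rpow_natCast_mul h0.le, ← rpow_natCast_mul h1.le, Nat.cast_sub hx, mul_assoc,
    mul_comm ν, mul_comm ν]

theorem log_Gamma_eq_stirlingError (z : ℝ) :
    log (Gamma (z + 1)) = z * log z - z + 1 / 2 * log (2 * π * z) + stirlingError z := by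
  rw [stirlingError]
  ring

theorem log_choose_eq_stirlingError {n x : ℕ} (hx : x ≤ n) :
    log (n.choose x) = log (Gamma (n + 1)) - log (Gamma (x + 1)) -
      log (Gamma (((n : ℝ) - x) + 1)) := by
  rw [Nat.cast_choose ℝ hx, ← Nat.cast_sub hx, Gamma_nat_eq_factorial, Gamma_nat_eq_factorial,
    Gamma_nat_eq_factorial, log_div (by positivity) (by positivity),
    log_mul (by positivity) (by positivity)]
  ring

theorem renyiEntropy_eq_stirlingError {n x : ℕ} (hx : 0 < x) (hxn : x < n) {ν : ℝ}
    (hν : 0 < ν) (hν1 : ν ≠ 1) :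
    renyiEntropy ν n x - 1 / 2 * log (2 * π * x * ((n : ℝ) - x) / (n : ℝ) ^ 3) =
      -log ν / (2 * (1 - ν)) + (1 - ν)⁻¹ *
        (ν * (stirlingError n - stirlingError x - stirlingError ((n : ℝ) - x)) +
          (stirlingError (ν * x) + stirlingError (ν * ((n : ℝ) - x)) - stirlingError (ν * n)) +
          (ν * log (1 + 1 / (n : ℝ)) - log (1 + 1 / (ν * n)))) := by
  have hx0 : (0 : ℝ) < x := by exact_mod_cast hx
  have hn0 : (0 : ℝ) < n := by exact_mod_cast hx.trans hxn
  have hm0 : (0 : ℝ) < (n : ℝ) - x := sub_pos.2 (by exact_mod_cast hxn)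
  have hν1' : 1 - ν ≠ 0 := sub_ne_zero.2 hν1.symm
  have hC : (0 : ℝ) < n.choose x := by exact_mod_cast Nat.choose_pos hxn.le
  have hsucc : log ((n : ℝ) + 1) = log n + log (1 + 1 / (n : ℝ)) := by
    rw [← log_mul hn0.ne' (by positivity)]
    congr 1
    field_simp
  have hνsucc : log (ν * n + 1) = log ν + log n + log (1 + 1 / (ν * n)) := by
    rw [← log_mul hν.ne' hn0.ne', ← log_mul (by positivity) (by positivity)]
    congr 1
    field_simp
  have hΓ {z : ℝ} (hz : 0 < z) : Gamma z ≠ 0 := (Gamma_pos_of_pos hz).ne'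
  rw [renyiEntropy, integral_betaDensity_rpow hxn.le hν, ProbabilityTheory.beta,
    show ν * x + 1 + (ν * ((n : ℝ) - x) + 1) = (ν * n + 1) + 1 by ring,
    Gamma_add_one (by positivity : ν * (n : ℝ) + 1 ≠ 0),
    log_mul (by positivity) (div_ne_zero
      (mul_ne_zero (hΓ (by positivity)) (hΓ (by positivity)))
      (mul_ne_zero (by positivity) (hΓ (by positivity)))),
    log_rpow (by positivity), log_mul (by positivity) hC.ne',
    log_div (mul_ne_zero (hΓ (by positivity)) (hΓ (by positivity)))
      (mul_ne_zero (by positivity) (hΓ (by positivity))),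
    log_mul (hΓ (by positivity)) (hΓ (by positivity)),
    log_mul (by positivity) (hΓ (by positivity)), hsucc, hνsucc,
    log_choose_eq_stirlingError hxn.le]
  simp only [log_Gamma_eq_stirlingError]
  have hlog {z : ℝ} (hz : 0 < z) : log (2 * π * z) = log (2 * π) + log z :=
    log_mul (by positivity) hz.ne'
  rw [log_div (by positivity) (by positivity), log_pow,
    log_mul (by positivity : 2 * π * (x : ℝ) ≠ 0) hm0.ne', hlog hx0, hlog hn0, hlog hm0, hlog (mul_pos hν hx0), hlog (mul_pos hν hm0),
    hlog (mul_pos hν hn0), log_mul hν.ne' hx0.ne', log_mul hν.ne' hm0.ne',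
    log_mul hν.ne' hn0.ne']
  generalize log (1 + 1 / (n : ℝ)) = a
  generalize log (1 + 1 / (ν * (n : ℝ))) = b
  field_simp
  ring

/-- For a sequence `x_n` with `x_n ≤ n`, `x_n → ∞` and `n - x_n → ∞`, and
`ν > 0`, `ν ≠ 1`, the Rényi entropy satisfies
`H_ν(f_{n,x_n}) - (1/2) log(2π x_n (n-x_n)/n³) → - log ν / (2(1-ν))`. -/
theorem renyi_entropy_asymptotics
    (x : ℕ → ℕ) (hx : ∀ n, x n ≤ n)
    (hxTop : Tendsto (fun n => x n) atTop atTop)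
    (hnxTop : Tendsto (fun n => n - x n) atTop atTop)
    (ν : ℝ) (hν : 0 < ν) (hν1 : ν ≠ 1) :
    Tendsto (fun n : ℕ =>
        renyiEntropy ν n (x n) -
          (1 / 2) * Real.log (2 * Real.pi * (x n : ℝ) * ((n : ℝ) - (x n : ℝ)) / (n : ℝ) ^ 3))
      atTop (nhds (-Real.log ν / (2 * (1 - ν)))) := by
  have hx' : Tendsto (fun n : ℕ => (x n : ℝ)) atTop atTop :=
    tendsto_natCast_atTop_atTop.comp hxTop
  have hm' : Tendsto (fun n : ℕ => (n : ℝ) - x n) atTop atTop :=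
    (tendsto_natCast_atTop_atTop.comp hnxTop).congr fun n => Nat.cast_sub (hx n)
  have hn' : Tendsto (fun n : ℕ => (n : ℝ)) atTop atTop := tendsto_natCast_atTop_atTop
  have error {u : ℕ → ℝ} (hu : Tendsto u atTop atTop) :
      Tendsto (fun n => stirlingError (u n)) atTop (nhds 0) := tendsto_stirlingError.comp hu
  have log_error {u : ℕ → ℝ} (hu : Tendsto u atTop atTop) :
      Tendsto (fun n => log (1 + 1 / u n)) atTop (nhds 0) := by
    have h : Tendsto (fun n => 1 + 1 / u n) atTop (nhds 1) := by
      simpa using hu.inv_tendsto_atTop.const_add 1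
    simpa using h.log one_ne_zero
  have main := (((((((error hn').sub (error hx')).sub (error hm')).const_mul ν).add
    (((error (hx'.const_mul_atTop hν)).add (error (hm'.const_mul_atTop hν))).sub
      (error (hn'.const_mul_atTop hν)))).add
    (((log_error hn').const_mul ν).sub (log_error (hn'.const_mul_atTop hν)))).const_mul
    (1 - ν)⁻¹).const_add (-log ν / (2 * (1 - ν)))
  simp only [sub_zero, mul_zero, add_zero] at main
  refine main.congr' ?_
  filter_upwards [hxTop.eventually_gt_atTop 0, hnxTop.eventually_gt_atTop 0] with n h1 h2
  exact (renyiEntropy_eq_stirlingError h1 (Nat.sub_pos_iff_lt.1 h2) hν hν1).symm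
end
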